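/- arXiv:math/9903166 — 7 statements merged into one kernel-verified Lean document; each statement's English description precedes it below -/
import Mathlib

section
/- There is an absolute constant C such that the following holds. Let v₁, v₂, v₃ be three linearly independent vectors in ℝ³, let F ⊆ ℝ³ be measurable, and let f₁, f₂, f₃ : ℝ³ → [0,∞] be measurable. Then ∫_F 𝔼_{v₁}(f₁)(x) · 𝔼_{v₂}(f₂)(x) · 𝔼_{v₃}(f₃)(x) dx ≤ C · sup_P (|F ∩ P| / |P|)^{1/3} · ‖f₁‖_{L³(ℝ³)} ‖f₂‖_{L³(ℝ³)} ‖f₃‖_{L³(ℝ³)}, where the supremum is over all parallelepipeds P with edge vectors v₁, v₂, v₃ (i.e. all translates of {t₁v₁ + t₂v₂ + t₃v₃ : 0 ≤ t₁, t₂, t₃ ≤ 1}). -/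
open MeasureTheory Set
open scoped ENNReal

noncomputable section

abbrev R3 : Type := EuclideanSpace ℝ (Fin 3)

/-- The averaging operator 𝔼_v f(x) = ∫_{|t| ≤ 1} f(x + t v) dt. -/
def avgOp (v : R3) (f : R3 → ℝ≥0∞) (x : R3) : ℝ≥0∞ :=
  ∫⁻ t in Set.Icc (-1 : ℝ) 1, f (x + t • v)

/-- The base parallelepiped with edge vectors v₁, v₂, v₃. -/
def para (v₁ v₂ v₃ : R3) : Set R3 :=
  {x | ∃ t₁ t₂ t₃ : ℝ, t₁ ∈ Set.Icc (0 : ℝ) 1 ∧ t₂ ∈ Set.Icc (0 : ℝ) 1 ∧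
    t₃ ∈ Set.Icc (0 : ℝ) 1 ∧ x = t₁ • v₁ + t₂ • v₂ + t₃ • v₃}

/-- The L³ norm of an ℝ≥0∞-valued function on ℝ³. -/
def lp3 (f : R3 → ℝ≥0∞) : ℝ≥0∞ :=
  (∫⁻ x : R3, f x ^ (3 : ℝ)) ^ ((1 : ℝ) / 3)

section LoomisWhitney

variable {X Y Z : Type*} [MeasurableSpace X] [MeasurableSpace Y] [MeasurableSpace Z]

/-- The Loomis–Whitney inequality in a product of three measure spaces, in terms of the squares of
the three functions. -/
theorem lintegral_loomis_whitney (μ : Measure X) (ν : Measure Y) (ρ : Measure Z)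
    [SFinite μ] [SFinite ν] [SFinite ρ] {a : Y × Z → ℝ≥0∞} {b : X × Z → ℝ≥0∞} {c : X × Y → ℝ≥0∞}
    (ha : Measurable a) (hb : Measurable b) (hc : Measurable c) :
    ∫⁻ p, a p.2 ^ (1 / 2 : ℝ) * b (p.1, p.2.2) ^ (1 / 2 : ℝ) * c (p.1, p.2.1) ^ (1 / 2 : ℝ)
        ∂(μ.prod (ν.prod ρ)) ≤
      ((∫⁻ q, a q ∂(ν.prod ρ)) * (∫⁻ q, b q ∂(μ.prod ρ)) * ∫⁻ q, c q ∂(μ.prod ν)) ^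
        (1 / 2 : ℝ) := by
  have inner (x : X) (y : Y) :
      ∫⁻ z, a (y, z) ^ (1 / 2 : ℝ) * b (x, z) ^ (1 / 2 : ℝ) ∂ρ ≤
        (∫⁻ z, a (y, z) ∂ρ) ^ (1 / 2 : ℝ) * (∫⁻ z, b (x, z) ∂ρ) ^ (1 / 2 : ℝ) :=
    ENNReal.lintegral_mul_norm_pow_le (by fun_prop) (by fun_prop) (by norm_num) (by norm_num)
      (by norm_num)
  have hA : Measurable fun y ↦ ∫⁻ z, a (y, z) ∂ρ := ha.lintegral_prod_right'
  have hB : Measurable fun x ↦ ∫⁻ z, b (x, z) ∂ρ := hb.lintegral_prod_right'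
  calc _ = ∫⁻ q, (∫⁻ z, a (q.2, z) ^ (1 / 2 : ℝ) * b (q.1, z) ^ (1 / 2 : ℝ) ∂ρ) *
            c q ^ (1 / 2 : ℝ) ∂(μ.prod ν) := by
        rw [lintegral_prod _ (by fun_prop), lintegral_prod _]
        · refine lintegral_congr fun x ↦ ?_
          rw [lintegral_prod _ (by fun_prop)]
          refine lintegral_congr fun y ↦ ?_
          rw [← lintegral_mul_const _ (by fun_prop)]
        · refine Measurable.aemeasurable (Measurable.mul ?_ (by fun_prop))
          exact Measurable.lintegral_prod_right'
            (f := fun p : (X × Y) × Z ↦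
              a (p.1.2, p.2) ^ (1 / 2 : ℝ) * b (p.1.1, p.2) ^ (1 / 2 : ℝ)) (by fun_prop)
    _ ≤ ∫⁻ q, ((∫⁻ z, a (q.2, z) ∂ρ) * ∫⁻ z, b (q.1, z) ∂ρ) ^ (1 / 2 : ℝ) *
            c q ^ (1 / 2 : ℝ) ∂(μ.prod ν) := by
        gcongr with q
        rw [ENNReal.mul_rpow_of_nonneg _ _ (by norm_num)]
        exact inner q.1 q.2
    _ ≤ (∫⁻ q, (∫⁻ z, a (q.2, z) ∂ρ) * ∫⁻ z, b (q.1, z) ∂ρ ∂(μ.prod ν)) ^ (1 / 2 : ℝ) *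
          (∫⁻ q, c q ∂(μ.prod ν)) ^ (1 / 2 : ℝ) :=
        ENNReal.lintegral_mul_norm_pow_le
          ((hA.comp measurable_snd).mul (hB.comp measurable_fst)).aemeasurable (by fun_prop)
          (by norm_num) (by norm_num) (by norm_num)
    _ = _ := by
        rw [← ENNReal.mul_rpow_of_nonneg _ _ (by norm_num)]
        congr 2
        have hAB : Measurable fun q : X × Y ↦ (∫⁻ z, a (q.2, z) ∂ρ) * ∫⁻ z, b (q.1, z) ∂ρ :=
          (hA.comp measurable_snd).mul (hB.comp measurable_fst)
        rw [lintegral_prod _ hAB.aemeasurable, lintegral_prod _ ha.aemeasurable,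
          lintegral_prod _ hb.aemeasurable,
          ← lintegral_const_mul _ hB]
        exact lintegral_congr fun x ↦ lintegral_mul_const (∫⁻ z, b (x, z) ∂ρ) hA

theorem lintegral_le_rpow_mul_measure_univ (μ : Measure X) {f : X → ℝ≥0∞} (hf : Measurable f) :
    ∫⁻ x, f x ∂μ ≤ (∫⁻ x, f x ^ (3 : ℝ) ∂μ) ^ (1 / 3 : ℝ) * μ univ ^ (2 / 3 : ℝ) := by
  have h := ENNReal.lintegral_mul_norm_pow_le (μ := μ) (f := fun x ↦ f x ^ (3 : ℝ))
    (g := fun _ ↦ 1) (p := 1 / 3) (q := 2 / 3) (by fun_prop) (by fun_prop) (by norm_num)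
    (by norm_num) (by norm_num)
  have hcube (x : X) : (f x ^ (3 : ℝ)) ^ (1 / 3 : ℝ) = f x := by
    rw [← ENNReal.rpow_mul]; norm_num
  simpa only [hcube, ENNReal.one_rpow, mul_one, lintegral_one] using h

theorem lintegral_mul_mul_rpow_third_le (μ : Measure X) {f g h : X → ℝ≥0∞} (hf : Measurable f)
    (hg : Measurable g) (hh : Measurable h) :
    ∫⁻ x, f x ^ (1 / 3 : ℝ) * g x ^ (1 / 3 : ℝ) * h x ^ (1 / 3 : ℝ) ∂μ ≤
      (∫⁻ x, f x ∂μ) ^ (1 / 3 : ℝ) * (∫⁻ x, g x ∂μ) ^ (1 / 3 : ℝ) *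
        (∫⁻ x, h x ∂μ) ^ (1 / 3 : ℝ) := by
  have key := ENNReal.lintegral_prod_norm_pow_le (μ := μ) Finset.univ (f := ![f, g, h])
    (p := fun _ ↦ 1 / 3) (by intro i _; fin_cases i <;> simp <;> fun_prop)
    (by simp) (by intros; norm_num)
  simpa [Fin.prod_univ_three] using key

/-- A Loomis–Whitney inequality for fibre integrals, restricted to a set `S`: the measure of `S`
is gained with exponent `1 / 3`. -/
theorem setLIntegral_fiber_mul_le (μ : Measure X) (ν : Measure Y) (ρ : Measure Z)
    [SFinite μ] [SFinite ν] [SFinite ρ] {S : Set (X × Y × Z)} {f g h : X × Y × Z → ℝ≥0∞}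
    (hf : Measurable f) (hg : Measurable g) (hh : Measurable h) :
    ∫⁻ p in S, (∫⁻ s, f (s, p.2) ∂μ) * (∫⁻ s, g (p.1, s, p.2.2) ∂ν) *
        (∫⁻ s, h (p.1, p.2.1, s) ∂ρ) ∂(μ.prod (ν.prod ρ)) ≤
      (μ univ * ν univ * ρ univ) ^ (2 / 3 : ℝ) * (μ.prod (ν.prod ρ) S) ^ (1 / 3 : ℝ) *
        (∫⁻ p, f p ^ (3 : ℝ) ∂(μ.prod (ν.prod ρ))) ^ (1 / 3 : ℝ) *
        (∫⁻ p, g p ^ (3 : ℝ) ∂(μ.prod (ν.prod ρ))) ^ (1 / 3 : ℝ) *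
        (∫⁻ p, h p ^ (3 : ℝ) ∂(μ.prod (ν.prod ρ))) ^ (1 / 3 : ℝ) := by
  set π := μ.prod (ν.prod ρ)
  let a : Y × Z → ℝ≥0∞ := fun q ↦ ∫⁻ s, f (s, q) ^ (3 : ℝ) ∂μ
  let b : X × Z → ℝ≥0∞ := fun q ↦ ∫⁻ s, g (q.1, s, q.2) ^ (3 : ℝ) ∂ν
  let c : X × Y → ℝ≥0∞ := fun q ↦ ∫⁻ s, h (q.1, q.2, s) ^ (3 : ℝ) ∂ρ
  have ha : Measurable a := (hf.pow_const (3 : ℝ)).lintegral_prod_left'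
  have hb : Measurable b := Measurable.lintegral_prod_right'
    (f := fun p : (X × Z) × Y ↦ g (p.1.1, p.2, p.1.2) ^ (3 : ℝ)) (by fun_prop)
  have hc : Measurable c := Measurable.lintegral_prod_right'
    (f := fun p : (X × Y) × Z ↦ h (p.1.1, p.1.2, p.2) ^ (3 : ℝ)) (by fun_prop)
  have ha' : ∫⁻ q, a q ∂(ν.prod ρ) = ∫⁻ p, f p ^ (3 : ℝ) ∂π :=
    (lintegral_prod_symm' _ (hf.pow_const 3)).symm
  have hb' : ∫⁻ q, b q ∂(μ.prod ρ) = ∫⁻ p, g p ^ (3 : ℝ) ∂π := by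
    rw [lintegral_prod _ hb.aemeasurable, lintegral_prod _ (by fun_prop)]
    exact lintegral_congr fun x ↦ (lintegral_prod_symm'
      (fun q : Y × Z ↦ g (x, q) ^ (3 : ℝ)) (by fun_prop)).symm
  have hc' : ∫⁻ q, c q ∂(μ.prod ν) = ∫⁻ p, h p ^ (3 : ℝ) ∂π := by
    rw [lintegral_prod _ hc.aemeasurable, lintegral_prod _ (by fun_prop)]
    exact lintegral_congr fun x ↦ (lintegral_prod
      (fun q : Y × Z ↦ h (x, q) ^ (3 : ℝ)) (by fun_prop)).symm
  set m := (μ univ * ν univ * ρ univ) ^ (2 / 3 : ℝ) with hm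
  let G : X × Y × Z → ℝ≥0∞ := fun p ↦
    a p.2 ^ (1 / 2 : ℝ) * b (p.1, p.2.2) ^ (1 / 2 : ℝ) * c (p.1, p.2.1) ^ (1 / 2 : ℝ)
  have hG : Measurable G := by fun_prop
  calc _ ≤ ∫⁻ p in S, m * (1 ^ (1 / 3 : ℝ) * G p ^ (2 / 3 : ℝ)) ∂π := by
        refine lintegral_mono fun p ↦ ?_
        calc _ ≤ (a p.2 ^ (1 / 3 : ℝ) * μ univ ^ (2 / 3 : ℝ)) *
                (b (p.1, p.2.2) ^ (1 / 3 : ℝ) * ν univ ^ (2 / 3 : ℝ)) *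
                (c (p.1, p.2.1) ^ (1 / 3 : ℝ) * ρ univ ^ (2 / 3 : ℝ)) := by
              refine mul_le_mul' (mul_le_mul' ?_ ?_) ?_ <;>
                exact lintegral_le_rpow_mul_measure_univ _ (by fun_prop)
          _ = _ := by
              simp only [G, hm, ENNReal.one_rpow, one_mul,
                ENNReal.mul_rpow_of_nonneg _ _ (by norm_num : (0 : ℝ) ≤ 2 / 3),
                ← ENNReal.rpow_mul]
              norm_num
              ring
    _ = m * ∫⁻ p in S, 1 ^ (1 / 3 : ℝ) * G p ^ (2 / 3 : ℝ) ∂π :=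
        lintegral_const_mul _ (by fun_prop)
    _ ≤ m * ((∫⁻ _ in S, 1 ∂π) ^ (1 / 3 : ℝ) * (∫⁻ p in S, G p ∂π) ^ (2 / 3 : ℝ)) := by
        gcongr
        exact ENNReal.lintegral_mul_norm_pow_le (by fun_prop) hG.aemeasurable (by norm_num)
          (by norm_num) (by norm_num)
    _ ≤ m * (π S ^ (1 / 3 : ℝ) *
          (((∫⁻ p, f p ^ (3 : ℝ) ∂π) * (∫⁻ p, g p ^ (3 : ℝ) ∂π) *
            ∫⁻ p, h p ^ (3 : ℝ) ∂π) ^ (1 / 2 : ℝ)) ^ (2 / 3 : ℝ)) := by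
        rw [setLIntegral_one, ← ha', ← hb', ← hc']
        gcongr
        exact (setLIntegral_le_lintegral _ _).trans (lintegral_loomis_whitney μ ν ρ ha hb hc)
    _ = _ := by
        rw [← ENNReal.rpow_mul]
        norm_num [ENNReal.mul_rpow_of_nonneg]
        ring

end LoomisWhitney

/-- Averaging the integral of `φ` over all translates of a set `B` gives the total integral,
multiplied by the measure of `B`. -/
theorem lintegral_setLIntegral_sub_mem {G : Type*} [AddCommGroup G] [MeasurableSpace G]
    [MeasurableAdd₂ G] [MeasurableNeg G] (μ : Measure G) [SFinite μ] [μ.IsAddLeftInvariant]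
    [μ.IsNegInvariant] {B : Set G} (hB : MeasurableSet B) {φ : G → ℝ≥0∞} (hφ : Measurable φ) :
    ∫⁻ p, ∫⁻ x in {x | x - p ∈ B}, φ x ∂μ ∂μ = μ B * ∫⁻ x, φ x ∂μ := by
  have hm : Measurable fun q : G × G ↦ B.indicator 1 (q.2 - q.1) * φ q.2 :=
    ((measurable_one.indicator hB).comp (measurable_snd.sub measurable_fst)).mul
      (hφ.comp measurable_snd)
  calc _ = ∫⁻ p, ∫⁻ x, B.indicator 1 (x - p) * φ x ∂μ ∂μ := by
        refine lintegral_congr fun p ↦ ?_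
        rw [← lintegral_indicator (by measurability)]
        refine lintegral_congr fun x ↦ ?_
        by_cases hx : x - p ∈ B <;> simp [indicator, hx]
    _ = ∫⁻ x, ∫⁻ p, B.indicator 1 (x - p) * φ x ∂μ ∂μ :=
        lintegral_lintegral_swap hm.aemeasurable
    _ = ∫⁻ x, μ B * φ x ∂μ := by
        refine lintegral_congr fun x ↦ ?_
        have hind : Measurable fun p ↦ B.indicator (1 : G → ℝ≥0∞) (x - p) :=
          (measurable_one.indicator hB).comp (measurable_const.sub measurable_id)
        rw [lintegral_mul_const _ hind,
          lintegral_sub_left_eq_self (B.indicator 1) x, lintegral_indicator_one hB]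
    _ = _ := lintegral_const_mul _ hφ

theorem measurable_setLIntegral_sub_mem {G : Type*} [AddCommGroup G] [MeasurableSpace G]
    [MeasurableAdd₂ G] [MeasurableNeg G] (μ : Measure G) [SFinite μ]
    {B : Set G} (hB : MeasurableSet B) {φ : G → ℝ≥0∞} (hφ : Measurable φ) :
    Measurable fun p ↦ ∫⁻ x in {x | x - p ∈ B}, φ x ∂μ := by
  have hS : MeasurableSet {q : G × G | q.2 - q.1 ∈ B} :=
    (measurable_snd.sub measurable_fst) hB
  have h : Measurable fun q : G × G ↦ {q : G × G | q.2 - q.1 ∈ B}.indicator (fun q ↦ φ q.2) q :=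
    (hφ.comp measurable_snd).indicator hS
  convert h.lintegral_prod_right' (ν := μ) using 2 with p
  rw [← lintegral_indicator (by measurability)]
  rfl

/-- The box `[-1, 2]³`. -/
abbrev bigBox : Set (ℝ × ℝ × ℝ) := Icc (-1) 2 ×ˢ Icc (-1) 2 ×ˢ Icc (-1) 2

/-- The box `[0, 1]³`. -/
abbrev unitBox : Set (ℝ × ℝ × ℝ) := Icc 0 1 ×ˢ Icc 0 1 ×ˢ Icc 0 1

theorem volume_unitBox : volume unitBox = 1 := by
  simp only [unitBox, Measure.volume_eq_prod, Measure.prod_prod, Real.volume_Icc]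
  norm_num

theorem volume_bigBox : volume bigBox = 27 := by
  simp only [bigBox, Measure.volume_eq_prod, Measure.prod_prod, Real.volume_Icc]
  norm_num

theorem measurableSet_unitBox : MeasurableSet unitBox :=
  measurableSet_Icc.prod (measurableSet_Icc.prod measurableSet_Icc)

theorem measurableSet_bigBox : MeasurableSet bigBox :=
  measurableSet_Icc.prod (measurableSet_Icc.prod measurableSet_Icc)

instance isAddHaarMeasure_volume_prod_prod : (volume : Measure (ℝ × ℝ × ℝ)).IsAddHaarMeasure :=
  Measure.prod.instIsAddHaarMeasure volume (volume.prod volume)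

theorem setLIntegral_Icc_add_le (φ : ℝ → ℝ≥0∞) {x a : ℝ} (hx : x - a ∈ Icc (0 : ℝ) 1) :
    ∫⁻ t in Icc (-1 : ℝ) 1, φ (x + t) ≤ ∫⁻ s in Icc (a - 1) (a + 2), φ s := by
  rw [← lintegral_indicator measurableSet_Icc, ← lintegral_indicator measurableSet_Icc,
    ← lintegral_add_left_eq_self ((Icc (a - 1) (a + 2)).indicator φ) x]
  refine lintegral_mono fun t ↦ ?_
  by_cases ht : t ∈ Icc (-1 : ℝ) 1
  · have hxt : x + t ∈ Icc (a - 1) (a + 2) := by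
      simp only [mem_Icc] at *
      constructor <;> linarith
    simp [ht, hxt]
  · simp [ht]

theorem measurable_lineAverage {E : Type*} [AddCommGroup E] [Module ℝ E] [MeasurableSpace E]
    [MeasurableAdd₂ E] [MeasurableSMul₂ ℝ E] (v : E) {f : E → ℝ≥0∞} (hf : Measurable f) :
    Measurable fun x ↦ ∫⁻ t in Icc (-1 : ℝ) 1, f (x + t • v) :=
  Measurable.lintegral_prod_right' (f := fun p : E × ℝ ↦ f (p.1 + p.2 • v)) (by fun_prop)

theorem setLIntegral_lineAverage_le (F : Set (ℝ × ℝ × ℝ)) {f g h : ℝ × ℝ × ℝ → ℝ≥0∞}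
    (hF : MeasurableSet F) (hf : Measurable f) (hg : Measurable g) (hh : Measurable h)
    (p : ℝ × ℝ × ℝ) :
    ∫⁻ x in F ∩ {x | x - p ∈ unitBox}, (∫⁻ t in Icc (-1 : ℝ) 1, f (x + t • (1, 0, 0))) *
        (∫⁻ t in Icc (-1 : ℝ) 1, g (x + t • (0, 1, 0))) *
        (∫⁻ t in Icc (-1 : ℝ) 1, h (x + t • (0, 0, 1))) ≤
      9 * volume (F ∩ {x | x - p ∈ unitBox}) ^ (1 / 3 : ℝ) *
        (∫⁻ x in {x | x - p ∈ bigBox}, f x ^ (3 : ℝ)) ^ (1 / 3 : ℝ) *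
        (∫⁻ x in {x | x - p ∈ bigBox}, g x ^ (3 : ℝ)) ^ (1 / 3 : ℝ) *
        (∫⁻ x in {x | x - p ∈ bigBox}, h x ^ (3 : ℝ)) ^ (1 / 3 : ℝ) := by
  obtain ⟨a, b, c⟩ := p
  set S := F ∩ {x | x - (a, b, c) ∈ unitBox}
  let μ (a : ℝ) : Measure ℝ := volume.restrict (Icc (a - 1) (a + 2))
  have hμ (a : ℝ) : μ a univ = 3 := by
    simp only [μ, Measure.restrict_apply_univ, Real.volume_Icc]
    norm_num
  have hbox : {x : ℝ × ℝ × ℝ | x - (a, b, c) ∈ bigBox} =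
      Icc (a - 1) (a + 2) ×ˢ Icc (b - 1) (b + 2) ×ˢ Icc (c - 1) (c + 2) := by
    ext ⟨x, y, z⟩
    simp only [mem_ofPred_eq, Prod.mk_sub_mk, mem_prod, mem_Icc]
    grind
  have hS : MeasurableSet S := hF.inter
    ((measurable_id.sub_const _) measurableSet_unitBox)
  have hprod : (μ a).prod ((μ b).prod (μ c)) =
      volume.restrict {x : ℝ × ℝ × ℝ | x - (a, b, c) ∈ bigBox} := by
    rw [hbox, Measure.prod_restrict, Measure.prod_restrict]
    rfl
  have hSbox : S ⊆ {x : ℝ × ℝ × ℝ | x - (a, b, c) ∈ bigBox} := by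
    rintro x ⟨-, hx⟩
    simp only [mem_ofPred_eq, mem_prod, mem_Icc] at hx ⊢
    grind
  have key := setLIntegral_fiber_mul_le (μ a) (μ b) (μ c) (S := S) hf hg hh
  rw [hprod, hμ, hμ, hμ, Measure.restrict_restrict hS, Measure.restrict_apply hS,
    inter_eq_left.2 hSbox] at key
  have hnine : (3 * 3 * 3 : ℝ≥0∞) ^ (2 / 3 : ℝ) = 9 := by
    rw [show (3 * 3 * 3 : ℝ≥0∞) = 3 ^ (3 : ℝ) by norm_num, ← ENNReal.rpow_mul]
    norm_num
  rw [hnine] at key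
  refine le_trans (setLIntegral_mono' hS fun x hx ↦ ?_) key
  obtain ⟨x, y, z⟩ := x
  obtain ⟨-, hx, hy, hz⟩ := hx
  refine mul_le_mul' (mul_le_mul' ?_ ?_) ?_
  · simpa using setLIntegral_Icc_add_le (fun s ↦ f (s, y, z)) hx
  · simpa using setLIntegral_Icc_add_le (fun s ↦ g (x, s, z)) hy
  · simpa using setLIntegral_Icc_add_le (fun s ↦ h (x, y, s)) hz

/-- The variant of the Loomis–Whitney inequality for the standard basis. -/
theorem setLIntegral_lineAverage_le_iSup (F : Set (ℝ × ℝ × ℝ)) {f g h : ℝ × ℝ × ℝ → ℝ≥0∞}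
    (hF : MeasurableSet F) (hf : Measurable f) (hg : Measurable g) (hh : Measurable h) :
    ∫⁻ x in F, (∫⁻ t in Icc (-1 : ℝ) 1, f (x + t • (1, 0, 0))) *
        (∫⁻ t in Icc (-1 : ℝ) 1, g (x + t • (0, 1, 0))) *
        (∫⁻ t in Icc (-1 : ℝ) 1, h (x + t • (0, 0, 1))) ≤
      243 * (⨆ p, volume (F ∩ {x | x - p ∈ unitBox})) ^ (1 / 3 : ℝ) *
        (∫⁻ x, f x ^ (3 : ℝ)) ^ (1 / 3 : ℝ) * (∫⁻ x, g x ^ (3 : ℝ)) ^ (1 / 3 : ℝ) *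
        (∫⁻ x, h x ^ (3 : ℝ)) ^ (1 / 3 : ℝ) := by
  set M := ⨆ p, volume (F ∩ {x | x - p ∈ unitBox})
  set H : ℝ × ℝ × ℝ → ℝ≥0∞ := fun x ↦ (∫⁻ t in Icc (-1 : ℝ) 1, f (x + t • (1, 0, 0))) *
        (∫⁻ t in Icc (-1 : ℝ) 1, g (x + t • (0, 1, 0))) *
        (∫⁻ t in Icc (-1 : ℝ) 1, h (x + t • (0, 0, 1)))
  have hH : Measurable H := ((measurable_lineAverage _ hf).mul (measurable_lineAverage _ hg)).mul
    (measurable_lineAverage _ hh)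
  let loc (φ : ℝ × ℝ × ℝ → ℝ≥0∞) (p : ℝ × ℝ × ℝ) : ℝ≥0∞ :=
    ∫⁻ x in {x | x - p ∈ bigBox}, φ x ^ (3 : ℝ)
  have hloc {φ : ℝ × ℝ × ℝ → ℝ≥0∞} (hφ : Measurable φ) : Measurable (loc φ) :=
    measurable_setLIntegral_sub_mem _ measurableSet_bigBox (hφ.pow_const 3)
  have lintegral_loc {φ : ℝ × ℝ × ℝ → ℝ≥0∞} (hφ : Measurable φ) :
      ∫⁻ p, loc φ p = 27 * ∫⁻ x, φ x ^ (3 : ℝ) := by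
    rw [← volume_bigBox]
    exact lintegral_setLIntegral_sub_mem _ measurableSet_bigBox (hφ.pow_const 3)
  have hcube : (27 : ℝ≥0∞) ^ (1 / 3 : ℝ) = 3 := by
    rw [show (27 : ℝ≥0∞) = 3 ^ (3 : ℝ) by norm_num, ← ENNReal.rpow_mul]
    norm_num
  calc ∫⁻ x in F, H x = ∫⁻ p, ∫⁻ x in F ∩ {x | x - p ∈ unitBox}, H x := by
        rw [← lintegral_indicator hF, ← one_mul (∫⁻ x, F.indicator H x), ← volume_unitBox,
          ← lintegral_setLIntegral_sub_mem _ measurableSet_unitBox (hH.indicator hF)]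
        refine lintegral_congr fun p ↦ ?_
        rw [lintegral_indicator hF, Measure.restrict_restrict hF]
    _ ≤ ∫⁻ p, 9 * M ^ (1 / 3 : ℝ) * (loc f p ^ (1 / 3 : ℝ) * loc g p ^ (1 / 3 : ℝ) *
          loc h p ^ (1 / 3 : ℝ)) := by
        refine lintegral_mono fun p ↦ ?_
        refine (setLIntegral_lineAverage_le F hF hf hg hh p).trans ?_
        simp only [← mul_assoc]
        gcongr
        exact le_iSup (fun p ↦ volume (F ∩ {x | x - p ∈ unitBox})) p
    _ ≤ 9 * M ^ (1 / 3 : ℝ) * ((∫⁻ p, loc f p) ^ (1 / 3 : ℝ) * (∫⁻ p, loc g p) ^ (1 / 3 : ℝ) *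
          (∫⁻ p, loc h p) ^ (1 / 3 : ℝ)) := by
        have hf' := hloc hf
        have hg' := hloc hg
        have hh' := hloc hh
        rw [lintegral_const_mul _ (by fun_prop)]
        gcongr
        exact lintegral_mul_mul_rpow_third_le _ hf' hg' hh'
    _ = _ := by
        rw [lintegral_loc hf, lintegral_loc hg, lintegral_loc hh]
        simp only [ENNReal.mul_rpow_of_nonneg _ _ (by norm_num : (0 : ℝ) ≤ 1 / 3), hcube]
        ring

/-- The linear map sending the standard basis to `v₁, v₂, v₃`. -/
def coordMap (v₁ v₂ v₃ : R3) : (ℝ × ℝ × ℝ) →ₗ[ℝ] R3 :=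
  (LinearMap.toSpanSingleton ℝ R3 v₁).coprod
    ((LinearMap.toSpanSingleton ℝ R3 v₂).coprod (LinearMap.toSpanSingleton ℝ R3 v₃))

theorem coordMap_apply (v₁ v₂ v₃ : R3) (p : ℝ × ℝ × ℝ) :
    coordMap v₁ v₂ v₃ p = p.1 • v₁ + p.2.1 • v₂ + p.2.2 • v₃ := by
  simp [coordMap, add_assoc]

theorem coordMap_injective {v₁ v₂ v₃ : R3} (hv : LinearIndependent ℝ ![v₁, v₂, v₃]) :
    Function.Injective (coordMap v₁ v₂ v₃) := by
  rw [injective_iff_map_eq_zero]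
  rintro ⟨x, y, z⟩ h
  rw [coordMap_apply] at h
  have := Fintype.linearIndependent_iff.1 hv ![x, y, z] (by simpa [Fin.sum_univ_three] using h)
  simpa [Fin.forall_fin_succ] using this

/-- The linear isomorphism sending the standard basis to `v₁, v₂, v₃`. -/
def coordEquiv {v₁ v₂ v₃ : R3} (hv : LinearIndependent ℝ ![v₁, v₂, v₃]) : (ℝ × ℝ × ℝ) ≃L[ℝ] R3 :=
  ((coordMap v₁ v₂ v₃).linearEquivOfInjective (coordMap_injective hv)
    (by simp)).toContinuousLinearEquiv

theorem coordEquiv_apply {v₁ v₂ v₃ : R3} (hv : LinearIndependent ℝ ![v₁, v₂, v₃])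
    (p : ℝ × ℝ × ℝ) : coordEquiv hv p = p.1 • v₁ + p.2.1 • v₂ + p.2.2 • v₃ :=
  coordMap_apply v₁ v₂ v₃ p

theorem coordEquiv_preimage_para {v₁ v₂ v₃ : R3} (hv : LinearIndependent ℝ ![v₁, v₂, v₃])
    (p : ℝ × ℝ × ℝ) :
    coordEquiv hv ⁻¹' ((coordEquiv hv p + ·) '' para v₁ v₂ v₃) = {x | x - p ∈ unitBox} := by
  ext x
  simp only [mem_preimage, mem_image, mem_ofPred_eq, para]
  constructor
  · rintro ⟨_, ⟨t₁, t₂, t₃, h₁, h₂, h₃, rfl⟩, h⟩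
    have hx : x - p = (t₁, t₂, t₃) := by
      apply (coordEquiv hv).injective
      rw [map_sub, ← h, coordEquiv_apply hv (t₁, t₂, t₃)]
      simp
    rw [hx]
    exact ⟨h₁, h₂, h₃⟩
  · rintro ⟨h₁, h₂, h₃⟩
    exact ⟨_, ⟨_, _, _, h₁, h₂, h₃, rfl⟩, by rw [← coordEquiv_apply hv]; simp⟩

/-- Lebesgue measure on `ℝ³` is a multiple of the image of Lebesgue measure under a linear
isomorphism. -/
theorem exists_volume_eq_smul_map (e : (ℝ × ℝ × ℝ) ≃L[ℝ] R3) :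
    ∃ k : ℝ≥0∞, k ≠ 0 ∧ k ≠ ∞ ∧ (volume : Measure R3) = k • (volume.map e) := by
  have := e.isAddHaarMeasure_map (volume : Measure (ℝ × ℝ × ℝ))
  have h := Measure.isAddLeftInvariant_eq_smul (volume : Measure R3) (volume.map e)
  refine ⟨_, ?_, ENNReal.coe_ne_top, h⟩
  simpa using (Measure.addHaarScalarFactor_pos_of_isAddHaarMeasure
    (volume : Measure R3) (volume.map e)).ne'

/-- A variant of the Loomis–Whitney inequality (Lemma 7.3): for linearly independent
v₁, v₂, v₃ and nonnegative f₁, f₂, f₃,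
∫_F 𝔼_{v₁}f₁ · 𝔼_{v₂}f₂ · 𝔼_{v₃}f₃ ≲ sup_P (|F∩P|/|P|)^{1/3} ∏ ‖f_i‖₃,
where P ranges over all translates of the parallelepiped with edge vectors v₁, v₂, v₃. -/
theorem loomis_whitney_variant :
    ∃ C : ℝ, 0 < C ∧
      ∀ v₁ v₂ v₃ : R3, LinearIndependent ℝ ![v₁, v₂, v₃] →
        ∀ F : Set R3, MeasurableSet F →
          ∀ f₁ f₂ f₃ : R3 → ℝ≥0∞, Measurable f₁ → Measurable f₂ → Measurable f₃ →
            (∫⁻ x in F, avgOp v₁ f₁ x * avgOp v₂ f₂ x * avgOp v₃ f₃ x) ≤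
              ENNReal.ofReal C *
                (⨆ x₀ : R3, volume (F ∩ ((x₀ + ·) '' para v₁ v₂ v₃)) /
                  volume (para v₁ v₂ v₃)) ^ ((1 : ℝ) / 3) *
                lp3 f₁ * lp3 f₂ * lp3 f₃ := by
  refine ⟨243, by norm_num, fun v₁ v₂ v₃ hv F hF f₁ f₂ f₃ hf₁ hf₂ hf₃ ↦ ?_⟩
  obtain ⟨k, hk0, hk, hvol⟩ := exists_volume_eq_smul_map (coordEquiv hv)
  set e := coordEquiv hv with he
  have hmap : volume.map e = volume.map e.toHomeomorph.toMeasurableEquiv := rfl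
  have hmeas (S : Set R3) : volume S = k * volume (e ⁻¹' S) := by
    rw [hvol, Measure.smul_apply, hmap, MeasurableEquiv.map_apply, smul_eq_mul]
    rfl
  have hlint (φ : R3 → ℝ≥0∞) : ∫⁻ x, φ x = k * ∫⁻ p, φ (e p) := by
    rw [hvol, lintegral_smul_measure, hmap, lintegral_map_equiv, smul_eq_mul]
    rfl
  have he1 : e (1, 0, 0) = v₁ := by simp [he, coordEquiv_apply]
  have he2 : e (0, 1, 0) = v₂ := by simp [he, coordEquiv_apply]
  have he3 : e (0, 0, 1) = v₃ := by simp [he, coordEquiv_apply]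
  have hpara : volume (para v₁ v₂ v₃) = k := by
    have h := coordEquiv_preimage_para hv 0
    simp only [map_zero, zero_add, image_id', sub_zero, ofPred_mem_eq] at h
    rw [hmeas, h, volume_unitBox, mul_one]
  have hsup : ⨆ x₀ : R3, volume (F ∩ ((x₀ + ·) '' para v₁ v₂ v₃)) / volume (para v₁ v₂ v₃) =
      ⨆ p, volume (e ⁻¹' F ∩ {x | x - p ∈ unitBox}) := by
    rw [← e.surjective.iSup_comp]
    refine iSup_congr fun p ↦ ?_
    rw [hpara, hmeas, preimage_inter, coordEquiv_preimage_para hv p,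
      ENNReal.mul_div_right_comm, ENNReal.div_self hk0 hk, one_mul]
  have hlp (f : R3 → ℝ≥0∞) :
      lp3 f = k ^ (1 / 3 : ℝ) * (∫⁻ p, f (e p) ^ (3 : ℝ)) ^ (1 / 3 : ℝ) := by
    rw [lp3, hlint, ENNReal.mul_rpow_of_nonneg _ _ (by norm_num)]
  have hk3 : k ^ (1 / 3 : ℝ) * k ^ (1 / 3 : ℝ) * k ^ (1 / 3 : ℝ) = k := by
    rw [← ENNReal.rpow_add _ _ hk0 hk, ← ENNReal.rpow_add _ _ hk0 hk]
    norm_num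
  have hem : Measurable e := e.continuous.measurable
  have key := setLIntegral_lineAverage_le_iSup (e ⁻¹' F) (hem hF) (hf₁.comp hem) (hf₂.comp hem)
    (hf₃.comp hem)
  simp only [Function.comp_apply, map_add, map_smul, he1, he2, he3] at key
  rw [hsup, hlp, hlp, hlp, ← lintegral_indicator hF, hlint]
  rw [← lintegral_indicator (hem hF)] at key
  calc _ ≤ k * _ := mul_le_mul_right key k
    _ = _ := by
        nth_rw 1 [← hk3]
        rw [show ENNReal.ofReal 243 = 243 by norm_num]
        ring

end
end

section
/- (Triple intersections: nonplanar case.) Let d ∈ (2,3) and 0 < ε ≪ 1. There exist constants A, C, c > 0 (depending only on d and the constant C₀ below) such that the following holds for all sufficiently small δ > 0, with ρ = δ^{1/2}. Let x₀ ∈ ℝ³, and for i = 1, 2, 3 let T_ρ^i be a ρ-tube containing x₀ and 𝕋_i a finite collection of δ-tubes each contained in T_ρ^i; set A_i = (⋃_{T∈𝕋_i} T) ∩ B(x₀, C₀ρ) and assume |B(x₀, 2C₀ρ) ∩ ⋃_{T∈𝕋_i} C₀T| ≤ δ^{−C₀√ε} δ^{3−d} ρ^d for each i. Let v_i be vectors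 with |v_i − ρ·dir(T_ρ^i)| ≤ C₀δ, let 1 < M ≤ δ^{−1/4}, and let F ⊆ ℝ³ be a set such that |F ∩ B(x, σ)| ≤ δ^{−√ε} δ^{3−d} σ^d for every x ∈ F and every δ ≤ σ ≤ 1. If the angle between v₁ and v₂ is at least M^{−1} and the angle between v₃ and the plane π(v₁,v₂) spanned by v₁, v₂ is at least ρM², then |A₁ ∩ A₂ ∩ A₃ ∩ F| ≤ A δ^{−C√ε} δ^{3−d} ρ^d M^{−c}. -/
open MeasureTheory Metric Set
open scoped ENNReal NNReal RealInnerProductSpace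

noncomputable section

/-- A tube core: a line segment joining the planes {z = 0} and {z = 1},
with orientation within 1/10 of the vertical. -/
structure Tube where
  p0 : R3
  p1 : R3
  h0 : p0 2 = 0
  h1 : p1 2 = 1
  hx : |(p1 - p0) 0| ≤ 1/10
  hy : |(p1 - p0) 1| ≤ 1/10

/-- The direction of a tube: the difference of its endpoints. -/
def Tube.dir (T : Tube) : R3 := T.p1 - T.p0

/-- The σ-tube associated to a tube core: the σ-neighbourhood of the segment. -/
def Tube.set (T : Tube) (σ : ℝ) : Set R3 :=
  Metric.thickening σ (segment ℝ T.p0 T.p1)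

/-- A direction: a vector (x, y, 1) within 1/10 of the vertical. -/
def IsDirection (v : R3) : Prop := v 2 = 1 ∧ |v 0| ≤ 1/10 ∧ |v 1| ≤ 1/10

/-- Two σ-tubes are equivalent (with constant C): each lies in the C-dilate of the other. -/
def TubeEquiv (C σ : ℝ) (T T' : Tube) : Prop :=
  T.set σ ⊆ T'.set (C * σ) ∧ T'.set σ ⊆ T.set (C * σ)

/-- A collection of σ-tubes is essentially distinct (with constant C): each of its
tubes is equivalent to at most C of the others. -/
def EssDistinct (C σ : ℝ) (𝕋 : Set Tube) : Prop :=
  𝕋.Finite ∧ ∀ T ∈ 𝕋, (({T' ∈ 𝕋 | T' ≠ T ∧ TubeEquiv C σ T T'}.ncard : ℝ)) ≤ C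

/-- A δ-separated set. -/
def Separated (δ : ℝ) (E : Set R3) : Prop :=
  ∀ x ∈ E, ∀ y ∈ E, x ≠ y → δ ≤ dist x y

/-- The directional multiplicity of 𝕋 at scale σ is at most m: at most m of the
tubes have directions in any cap of radius σ. -/
def DirMultLE (σ : ℝ) (𝕋 : Set Tube) (m : ℝ) : Prop :=
  ∀ ω : R3, (({T ∈ 𝕋 | dist T.dir ω ≤ σ}.ncard : ℝ)) ≤ m

/-- The multiplicity function ∑_{T ∈ 𝕋} χ_T of a collection of σ-tubes. -/
def tubeCount (σ : ℝ) (𝕋 : Set Tube) (x : R3) : ℝ :=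
  (({T ∈ 𝕋 | x ∈ T.set σ}).ncard : ℝ)

/-- The L^p norm ‖∑_{T ∈ 𝕋} χ_T‖_{L^p(ℝ³)}. -/
def tubeNorm (σ p : ℝ) (𝕋 : Set Tube) : ℝ≥0∞ :=
  (∫⁻ x : R3, ENNReal.ofReal (tubeCount σ 𝕋 x ^ p)) ^ (1 / p)

/-- An X-ray estimate at dimension d with exponents α, β and constant A₀:
for every 0 < δ < 1, every δ-separated set of directions 𝓔 and every collection 𝕋 of
essentially distinct δ-tubes pointing in directions in 𝓔,
‖∑_{T∈𝕋} χ_T‖_{d'} ≤ A₀ δ^{1-3/d} m^{1-β} (δ² #𝓔)^α where m bounds the directional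
multiplicity of 𝕋 and d' = d/(d-1). -/
def XRayEstimate (Ceq d α β A₀ : ℝ) : Prop :=
  ∀ δ : ℝ, 0 < δ → δ < 1 →
    ∀ 𝓔 : Set R3, (∀ v ∈ 𝓔, IsDirection v) → Separated δ 𝓔 → 𝓔.Finite →
      ∀ 𝕋 : Set Tube, EssDistinct Ceq δ 𝕋 → (∀ T ∈ 𝕋, T.dir ∈ 𝓔) →
        ∀ m : ℝ, DirMultLE δ 𝕋 m →
          tubeNorm δ (d / (d - 1)) 𝕋 ≤
            ENNReal.ofReal (A₀ * δ ^ (1 - 3 / d) * m ^ (1 - β) * (δ ^ 2 * 𝓔.ncard) ^ α)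

/-- A Kakeya estimate at dimension d with exponent α and constant A₀ (the β = 0
case of the X-ray estimate). -/
def KakeyaEstimate (Ceq d α A₀ : ℝ) : Prop :=
  ∀ δ : ℝ, 0 < δ → δ < 1 →
    ∀ 𝓔 : Set R3, (∀ v ∈ 𝓔, IsDirection v) → Separated δ 𝓔 → 𝓔.Finite →
      ∀ 𝕋 : Set Tube, EssDistinct Ceq δ 𝕋 → (∀ T ∈ 𝕋, T.dir ∈ 𝓔) →
        ∀ m : ℝ, DirMultLE δ 𝕋 m →
          tubeNorm δ (d / (d - 1)) 𝕋 ≤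
            ENNReal.ofReal (A₀ * δ ^ (1 - 3 / d) * m * (δ ^ 2 * 𝓔.ncard) ^ α)

/-- The angle between a vector v₃ and the plane spanned by v₁ and v₂: the infimum of
the angles between v₃ and nonzero vectors of the plane. -/
def angleToPlane (v₁ v₂ v₃ : R3) : ℝ :=
  sInf {θ : ℝ | ∃ u : R3, u ∈ Submodule.span ℝ ({v₁, v₂} : Set R3) ∧ u ≠ 0 ∧
    θ = InnerProductGeometry.angle v₃ u}

/-- Tonelli: the average over all translates of `U` of the measure of `N ∩ (x + U)`. -/
lemma lintegral_measure_inter_translate {E : Type*} [AddCommGroup E] [MeasurableSpace E]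
    [MeasurableAdd₂ E] [MeasurableNeg E] (μ : Measure E) [SFinite μ] [μ.IsAddLeftInvariant]
    [μ.IsNegInvariant] {N U : Set E} (hN : MeasurableSet N) (hU : MeasurableSet U) :
    ∫⁻ x, μ (N ∩ {y | y - x ∈ U}) ∂μ = μ N * μ U := by
  have hm : MeasurableSet {p : E × E | p.2 ∈ N ∧ p.2 - p.1 ∈ U} :=
    (measurable_snd hN).inter ((measurable_snd.sub measurable_fst) hU)
  have h₁ := Measure.prod_apply (μ := μ) (ν := μ) hm
  have h₂ := Measure.prod_apply_symm (μ := μ) (ν := μ) hm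
  rw [h₁] at h₂
  refine Eq.trans h₂ ?_
  have h₃ : ∀ y, μ ((fun x => (x, y)) ⁻¹' {p : E × E | p.2 ∈ N ∧ p.2 - p.1 ∈ U}) =
      N.indicator (fun _ => μ U) y := by
    intro y
    by_cases hy : y ∈ N
    · rw [indicator_of_mem hy]
      rw [← (Measure.measurePreserving_sub_left μ y).measure_preimage hU.nullMeasurableSet]
      congr 1
      ext x
      simp [hy]
    · simp [hy]
  simp_rw [h₃]
  rw [lintegral_indicator hN, setLIntegral_const, mul_comm]

/-- Enlarging the radius of a neighbourhood by a factor `R` enlarges its volume by at most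
`(R + 1) ^ 3`. -/
lemma volume_thickening_mul_le (G : Set R3) {δ R : ℝ} (hδ : 0 < δ) (hR : 0 ≤ R) :
    volume (thickening (R * δ) G) ≤ ENNReal.ofReal ((R + 1) ^ 3) * volume (thickening δ G) := by
  have hT := lintegral_measure_inter_translate (volume : Measure R3)
    (N := thickening δ G) (U := ball 0 ((R + 1) * δ)) isOpen_thickening.measurableSet
    measurableSet_ball
  have hlow : volume (ball (0 : R3) δ) * volume (thickening (R * δ) G) ≤
      ∫⁻ x, volume (thickening δ G ∩ {y | y - x ∈ ball (0 : R3) ((R + 1) * δ)}) := by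
    rw [← setLIntegral_const]
    refine le_trans (setLIntegral_mono' isOpen_thickening.measurableSet fun x hx => ?_)
      (setLIntegral_le_lintegral _ _)
    obtain ⟨g, hg, hxg⟩ := mem_thickening_iff.1 hx
    rw [← Measure.addHaar_ball_center volume g δ]
    refine measure_mono fun y hy => ⟨mem_thickening_iff.2 ⟨g, hg, hy⟩, ?_⟩
    rw [mem_ofPred_eq, mem_ball_zero_iff, ← dist_eq_norm]
    have := dist_triangle y g x
    rw [mem_ball] at hy
    rw [dist_comm] at hxg
    linarith
  rw [hT, Measure.addHaar_ball_mul volume 0 (by linarith : 0 ≤ R + 1)] at hlow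
  have h0 : volume (ball (0 : R3) δ) ≠ 0 := (measure_ball_pos _ _ hδ).ne'
  have ht : volume (ball (0 : R3) δ) ≠ ⊤ := measure_ball_lt_top.ne
  simp only [finrank_euclideanSpace, Fintype.card_fin] at hlow
  refine (ENNReal.mul_le_mul_iff_right h0 ht).1 (hlow.trans (le_of_eq ?_))
  ring

/-- If all translates of `S` by `s • w`, `s ∈ [0, 1]`, stay in `B`, then up to a set of volume
`η |B|` the points of `S` see at least `η` of `S` in the direction `w`. -/
lemma exists_subset_directional_density {S B : Set R3} (hS : MeasurableSet S)
    (hB : MeasurableSet B) (w : R3) (h : ∀ y ∈ S, ∀ s ∈ Icc (0 : ℝ) 1, y + s • w ∈ B)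
    (η : ℝ≥0∞) :
    ∃ S' ⊆ S, MeasurableSet S' ∧
      (∀ x ∈ S', η ≤ volume {s : ℝ | s ∈ Icc (-1 : ℝ) 1 ∧ x + s • w ∈ S}) ∧
      volume S ≤ volume S' + η * volume B := by
  have hmS : MeasurableSet {p : R3 × ℝ | p.2 ∈ Icc (-1 : ℝ) 1 ∧ p.1 + p.2 • w ∈ S} :=
    (measurable_snd measurableSet_Icc).inter
      ((by fun_prop : Measurable fun p : R3 × ℝ => p.1 + p.2 • w) hS)
  have hf : Measurable fun x : R3 => volume {s : ℝ | s ∈ Icc (-1 : ℝ) 1 ∧ x + s • w ∈ S} :=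
    measurable_measure_prodMk_left hmS
  set S' : Set R3 := S ∩ {x | η ≤ volume {s : ℝ | s ∈ Icc (-1 : ℝ) 1 ∧ x + s • w ∈ S}} with hS'
  have hS'm : MeasurableSet S' := hS.inter (measurableSet_le measurable_const hf)
  refine ⟨S', inter_subset_left, hS'm, fun x hx => hx.2, ?_⟩
  set D : Set R3 := S \ S' with hD
  have hDm : MeasurableSet D := hS.diff hS'm
  have hSle : volume S ≤ volume S' + volume D := by
    rw [hD, ← measure_union disjoint_sdiff_right (hS.diff hS'm)]
    exact measure_mono (by rw [union_sdiff_self]; exact subset_union_right)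
  refine hSle.trans (add_le_add le_rfl ?_)
  have hm : MeasurableSet {p : R3 × ℝ | p.2 ∈ Icc (0 : ℝ) 1 ∧ p.1 - p.2 • w ∈ D} :=
    (measurable_snd measurableSet_Icc).inter
      ((by fun_prop : Measurable fun p : R3 × ℝ => p.1 - p.2 • w) hDm)
  have h₁ := Measure.prod_apply (μ := (volume : Measure R3)) (ν := (volume : Measure ℝ)) hm
  rw [Measure.prod_apply_symm hm] at h₁
  have h₂ : ∀ s : ℝ, volume ((fun x : R3 => (x, s)) ⁻¹'
      {p : R3 × ℝ | p.2 ∈ Icc (0 : ℝ) 1 ∧ p.1 - p.2 • w ∈ D}) =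
      (Icc (0 : ℝ) 1).indicator (fun _ => volume D) s := by
    intro s
    by_cases hs : s ∈ Icc (0 : ℝ) 1
    · rw [indicator_of_mem hs, ← measure_preimage_add_right volume (-(s • w)) D]
      congr 1
      ext x
      simp only [mem_preimage, mem_ofPred_eq, hs, true_and, sub_eq_add_neg]
    · rw [indicator_of_notMem hs]
      simp only [preimage_ofPred_eq, hs, false_and, ofPred_false, measure_empty]
  simp_rw [h₂] at h₁
  rw [lintegral_indicator measurableSet_Icc, setLIntegral_const, Real.volume_Icc] at h₁
  simp only [sub_zero, ENNReal.ofReal_one, mul_one] at h₁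
  rw [h₁, ← setLIntegral_const, ← lintegral_indicator hB]
  refine lintegral_mono fun x => ?_
  rcases eq_empty_or_nonempty (Prod.mk x ⁻¹'
      {p : R3 × ℝ | p.2 ∈ Icc (0 : ℝ) 1 ∧ p.1 - p.2 • w ∈ D}) with he | ⟨s₀, hs₀, hs₀D⟩
  · rw [he, measure_empty]
    exact zero_le
  simp only at hs₀ hs₀D
  have hxB : x ∈ B := by simpa using h _ hs₀D.1 s₀ hs₀
  rw [indicator_of_mem hxB]
  have hlt : volume {s : ℝ | s ∈ Icc (-1 : ℝ) 1 ∧ (x - s₀ • w) + s • w ∈ S} < η := by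
    by_contra! hcon
    exact hs₀D.2 ⟨hs₀D.1, hcon⟩
  refine le_trans ?_ hlt.le
  have hms : MeasurableSet {s : ℝ | s ∈ Icc (-1 : ℝ) 1 ∧ (x - s₀ • w) + s • w ∈ S} :=
    measurable_prodMk_left hmS
  rw [← (Measure.measurePreserving_sub_left volume s₀).measure_preimage hms.nullMeasurableSet]
  refine measure_mono fun s hs => ?_
  obtain ⟨hs, hsD⟩ := hs
  simp only at hs hsD
  refine ⟨⟨by linarith [hs.2, hs₀.1], by linarith [hs.1, hs₀.2]⟩, ?_⟩
  have : x - s₀ • w + (s₀ - s) • w = x - s • w := by module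
  rw [this]
  exact hsD.1

/-- Linear change of variables: a set with density at most `l` in every ball of radius `σ` meets
every affine box containing such a ball, up to a factor `64`, in proportion at most `l`. -/
lemma volume_parameters_le {S : Set R3} (hS : MeasurableSet S) {σ : ℝ} (hσ : 0 < σ) {l : ℝ≥0∞}
    (hl : ∀ z, volume (S ∩ ball z σ) ≤ l * volume (ball (0 : R3) σ)) (w₁ w₂ w₃ : R3)
    (hw : ∀ a b e : ℝ, ‖a • w₁ + b • w₂ + e • w₃‖ < σ → |a| ≤ 1 ∧ |b| ≤ 1 ∧ |e| ≤ 1) (x : R3) :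
    volume {q : ℝ × ℝ × ℝ | q.1 ∈ Icc (-1 : ℝ) 1 ∧ q.2.1 ∈ Icc (-1 : ℝ) 1 ∧
      q.2.2 ∈ Icc (-1 : ℝ) 1 ∧ x + q.1 • w₁ + q.2.1 • w₂ + q.2.2 • w₃ ∈ S} ≤ 64 * l := by
  set L₀ : (ℝ × ℝ × ℝ) →ₗ[ℝ] R3 :=
    { toFun := fun q => q.1 • w₁ + q.2.1 • w₂ + q.2.2 • w₃
      map_add' := fun p q => by simp only [Prod.fst_add, Prod.snd_add]; module
      map_smul' := fun c q => by
        simp only [Prod.smul_fst, Prod.smul_snd, smul_eq_mul, RingHom.id_apply]; module } with hL₀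
  have hL₀a : ∀ q, L₀ q = q.1 • w₁ + q.2.1 • w₂ + q.2.2 • w₃ := fun q => rfl
  have hsmall : ∀ c : ℝ, (∀ t : ℝ, |t * c| ≤ 1) → c = 0 := by
    intro c hc
    by_contra h0
    have := hc (2 / c)
    rw [div_mul_cancel₀ _ h0] at this
    norm_num at this
  have hinj : Function.Injective L₀ := by
    rw [injective_iff_map_eq_zero]
    intro q hq
    have hall : ∀ t : ℝ, |t * q.1| ≤ 1 ∧ |t * q.2.1| ≤ 1 ∧ |t * q.2.2| ≤ 1 := by
      intro t
      apply hw
      have : (t * q.1) • w₁ + (t * q.2.1) • w₂ + (t * q.2.2) • w₃ = t • L₀ q := by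
        rw [hL₀a]; module
      rw [this, hq]
      simpa using hσ
    ext
    · exact hsmall _ fun t => (hall t).1
    · exact hsmall _ fun t => (hall t).2.1
    · exact hsmall _ fun t => (hall t).2.2
  set L : (ℝ × ℝ × ℝ) ≃L[ℝ] R3 :=
    (LinearMap.linearEquivOfInjective L₀ hinj (by simp)).toContinuousLinearEquiv with hL
  have hLa : ∀ q, L q = q.1 • w₁ + q.2.1 • w₂ + q.2.2 • w₃ := fun q => rfl
  have hLm : Measurable L := L.continuous.measurable
  have hR2 : (volume : Measure (ℝ × ℝ)).IsAddHaarMeasure :=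
    inferInstanceAs ((volume : Measure ℝ).prod (volume : Measure ℝ)).IsAddHaarMeasure
  have hR3 : (volume : Measure (ℝ × ℝ × ℝ)).IsAddHaarMeasure :=
    inferInstanceAs ((volume : Measure ℝ).prod (volume : Measure (ℝ × ℝ))).IsAddHaarMeasure
  obtain ⟨c, hc⟩ : ∃ c : ℝ≥0∞, ∀ X : Set R3, MeasurableSet X → volume (L ⁻¹' X) = c * volume X := by
    have : (Measure.map L (volume : Measure (ℝ × ℝ × ℝ))).IsAddHaarMeasure :=
      L.isAddHaarMeasure_map _
    have hmap := Measure.isAddLeftInvariant_eq_smul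
      (Measure.map L (volume : Measure (ℝ × ℝ × ℝ))) (volume : Measure R3)
    refine ⟨((Measure.map L (volume : Measure (ℝ × ℝ × ℝ))).addHaarScalarFactor
      (volume : Measure R3) : ℝ≥0), fun X hX => ?_⟩
    rw [← Measure.map_apply hLm hX]
    exact congrArg (fun m : Measure R3 => m X) hmap
  set N : Set (ℝ × ℝ × ℝ) := {q | q.1 ∈ Icc (-1 : ℝ) 1 ∧ q.2.1 ∈ Icc (-1 : ℝ) 1 ∧
      q.2.2 ∈ Icc (-1 : ℝ) 1 ∧ x + q.1 • w₁ + q.2.1 • w₂ + q.2.2 • w₃ ∈ S} with hN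
  have hNm : MeasurableSet N :=
    (measurable_fst measurableSet_Icc).inter ((measurable_snd.fst measurableSet_Icc).inter
      ((measurable_snd.snd measurableSet_Icc).inter
        ((by fun_prop : Measurable fun q : ℝ × ℝ × ℝ =>
          x + q.1 • w₁ + q.2.1 • w₂ + q.2.2 • w₃) hS)))
  set U : Set (ℝ × ℝ × ℝ) := L ⁻¹' ball 0 σ with hU
  have hUo : IsOpen U := isOpen_ball.preimage L.continuous
  have hUb : U ⊆ Icc (-1 : ℝ) 1 ×ˢ (Icc (-1 : ℝ) 1 ×ˢ Icc (-1 : ℝ) 1) := by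
    intro q hq
    have := hw q.1 q.2.1 q.2.2 (by simpa [hU, hLa] using hq)
    simp only [abs_le] at this
    exact ⟨this.1, this.2.1, this.2.2⟩
  have hU0 : volume U ≠ 0 := (hUo.measure_pos volume ⟨0, by simp [hU, hσ]⟩).ne'
  have hUt : volume U ≠ ⊤ := by
    refine ((measure_mono hUb).trans_lt ?_).ne
    exact (isCompact_Icc.prod (isCompact_Icc.prod isCompact_Icc)).measure_lt_top
  have key := lintegral_measure_inter_translate (volume : Measure (ℝ × ℝ × ℝ)) hNm
    hUo.measurableSet
  set Q : Set (ℝ × ℝ × ℝ) := Icc (-2 : ℝ) 2 ×ˢ (Icc (-2 : ℝ) 2 ×ˢ Icc (-2 : ℝ) 2) with hQ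
  have hQm : MeasurableSet Q :=
    measurableSet_Icc.prod (measurableSet_Icc.prod measurableSet_Icc)
  have hQv : volume Q = 64 := by
    rw [hQ, Measure.volume_eq_prod, Measure.prod_prod, Measure.volume_eq_prod, Measure.prod_prod,
      Real.volume_Icc, ← ENNReal.ofReal_mul (by norm_num), ← ENNReal.ofReal_mul (by norm_num)]
    norm_num
  have hup : ∫⁻ q, volume (N ∩ {y | y - q ∈ U}) ≤ ∫⁻ q, Q.indicator (fun _ => l * volume U) q := by
    refine lintegral_mono fun q => ?_
    by_cases hq : q ∈ Q
    · rw [indicator_of_mem hq, hU, hc _ measurableSet_ball]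
      calc volume (N ∩ {y | y - q ∈ L ⁻¹' ball 0 σ})
          ≤ volume (L ⁻¹' ((fun y => x + y) ⁻¹' (S ∩ ball (x + L q) σ))) := by
            refine measure_mono fun y hy => ⟨?_, ?_⟩
            · have := hy.1.2.2.2
              rw [hLa]
              convert this using 1
              module
            · have := hy.2
              simp only [mem_ofPred_eq, mem_preimage, map_sub, mem_ball_zero_iff] at this
              simpa [mem_ball, dist_eq_norm] using this
        _ = c * volume (S ∩ ball (x + L q) σ) := by
            rw [hc _ ((measurable_const_add x) (hS.inter measurableSet_ball)),
              measure_preimage_add]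
        _ ≤ c * (l * volume (ball (0 : R3) σ)) := by gcongr; exact hl _
        _ = l * (c * volume (ball (0 : R3) σ)) := by ring
    · rw [indicator_of_notMem hq, nonpos_iff_eq_zero]
      convert measure_empty (μ := (volume : Measure (ℝ × ℝ × ℝ)))
      rw [eq_empty_iff_forall_notMem]
      rintro y ⟨⟨h₁, h₂, h₃, -⟩, hy⟩
      obtain ⟨h₁', h₂', h₃'⟩ := hUb hy
      simp only [Prod.fst_sub, Prod.snd_sub, mem_Icc] at h₁ h₂ h₃ h₁' h₂' h₃'
      refine hq ⟨⟨?_, ?_⟩, ⟨?_, ?_⟩, ⟨?_, ?_⟩⟩ <;> linarith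
  rw [key, lintegral_indicator hQm, setLIntegral_const, hQv] at hup
  refine (ENNReal.mul_le_mul_iff_left hU0 hUt).1 (hup.trans (le_of_eq ?_))
  ring

/-- A set whose translates along three directions stay in sets of volume at most `κ`, and which has
small density `l` in all balls of radius `σ` contained in the box spanned by these directions, has
volume at most `3 η κ` as soon as `η ^ 3 > 64 l`. -/
lemma volume_le_of_three_directions {S B₁ B₂ B₃ : Set R3} (hS : MeasurableSet S)
    (hB₁ : MeasurableSet B₁) (hB₂ : MeasurableSet B₂) (hB₃ : MeasurableSet B₃)
    {w₁ w₂ w₃ : R3}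
    (h₁ : ∀ y ∈ S, ∀ s ∈ Icc (0 : ℝ) 1, y + s • w₁ ∈ B₁)
    (h₂ : ∀ y ∈ S, ∀ s ∈ Icc (0 : ℝ) 1, y + s • w₂ ∈ B₂)
    (h₃ : ∀ y ∈ S, ∀ s ∈ Icc (0 : ℝ) 1, y + s • w₃ ∈ B₃)
    {σ : ℝ} (hσ : 0 < σ) {l η κ : ℝ≥0∞}
    (hl : ∀ z, volume (S ∩ ball z σ) ≤ l * volume (ball (0 : R3) σ))
    (hw : ∀ a b e : ℝ, ‖a • w₁ + b • w₂ + e • w₃‖ < σ → |a| ≤ 1 ∧ |b| ≤ 1 ∧ |e| ≤ 1)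
    (hκ₁ : volume B₁ ≤ κ) (hκ₂ : volume B₂ ≤ κ) (hκ₃ : volume B₃ ≤ κ)
    (hη : 64 * l < η ^ 3) :
    volume S ≤ 3 * η * κ := by
  obtain ⟨S₃, hS₃, hS₃m, hd₃, hv₃⟩ := exists_subset_directional_density hS hB₃ w₃ h₃ η
  obtain ⟨S₂, hS₂, hS₂m, hd₂, hv₂⟩ := exists_subset_directional_density hS₃m hB₂ w₂
    (fun y hy => h₂ y (hS₃ hy)) η
  obtain ⟨S₁, hS₁, hS₁m, hd₁, hv₁⟩ := exists_subset_directional_density hS₂m hB₁ w₁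
    (fun y hy => h₁ y (hS₃ (hS₂ hy))) η
  rcases eq_empty_or_nonempty S₁ with he | ⟨x, hx⟩
  · rw [he, measure_empty, zero_add] at hv₁
    calc volume S ≤ η * volume B₁ + η * volume B₂ + η * volume B₃ :=
          hv₃.trans (by gcongr; exact hv₂.trans (by gcongr))
      _ ≤ η * κ + η * κ + η * κ := by gcongr
      _ = 3 * η * κ := by ring
  exfalso
  refine absurd (volume_parameters_le hS hσ hl w₁ w₂ w₃ hw x) (not_le.2 (hη.trans_le ?_))
  have hNm : MeasurableSet {q : ℝ × ℝ × ℝ | q.1 ∈ Icc (-1 : ℝ) 1 ∧ q.2.1 ∈ Icc (-1 : ℝ) 1 ∧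
      q.2.2 ∈ Icc (-1 : ℝ) 1 ∧ x + q.1 • w₁ + q.2.1 • w₂ + q.2.2 • w₃ ∈ S} :=
    (measurable_fst measurableSet_Icc).inter ((measurable_snd.fst measurableSet_Icc).inter
      ((measurable_snd.snd measurableSet_Icc).inter
        ((by fun_prop : Measurable fun q : ℝ × ℝ × ℝ =>
          x + q.1 • w₁ + q.2.1 • w₂ + q.2.2 • w₃) hS)))
  have hm₁ : MeasurableSet {s : ℝ | s ∈ Icc (-1 : ℝ) 1 ∧ x + s • w₁ ∈ S₂} :=
    measurableSet_Icc.inter ((by fun_prop : Measurable fun s : ℝ => x + s • w₁) hS₂m)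
  rw [Measure.volume_eq_prod, Measure.prod_apply hNm]
  calc η ^ 3 = η ^ 2 * η := by ring
    _ ≤ η ^ 2 * volume {s : ℝ | s ∈ Icc (-1 : ℝ) 1 ∧ x + s • w₁ ∈ S₂} := by gcongr; exact hd₁ x hx
    _ = ∫⁻ _ in {s : ℝ | s ∈ Icc (-1 : ℝ) 1 ∧ x + s • w₁ ∈ S₂}, η ^ 2 := by
        rw [setLIntegral_const]
    _ ≤ _ := (setLIntegral_mono' hm₁ ?_).trans (setLIntegral_le_lintegral _ _)
  rintro s ⟨hs, hsS⟩
  have hm₂ : MeasurableSet {t : ℝ | t ∈ Icc (-1 : ℝ) 1 ∧ x + s • w₁ + t • w₂ ∈ S₃} :=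
    measurableSet_Icc.inter ((by fun_prop : Measurable fun t : ℝ => x + s • w₁ + t • w₂) hS₃m)
  rw [Measure.volume_eq_prod, Measure.prod_apply (measurable_prodMk_left hNm)]
  calc η ^ 2 = η * η := by ring
    _ ≤ η * volume {t : ℝ | t ∈ Icc (-1 : ℝ) 1 ∧ x + s • w₁ + t • w₂ ∈ S₃} := by
        gcongr; exact hd₂ _ hsS
    _ = ∫⁻ _ in {t : ℝ | t ∈ Icc (-1 : ℝ) 1 ∧ x + s • w₁ + t • w₂ ∈ S₃}, η := by
        rw [setLIntegral_const]
    _ ≤ _ := (setLIntegral_mono' hm₂ ?_).trans (setLIntegral_le_lintegral _ _)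
  rintro t ⟨ht, htS⟩
  refine (hd₃ _ htS).trans (measure_mono ?_)
  rintro r ⟨hr, hrS⟩
  exact ⟨hs, ht, hr, hrS⟩

/-- If `x` makes an angle at least `θ` with every nonzero vector of `W`, it is at distance at least
`(2 / π) θ ‖x‖` from every vector of `W`. -/
lemma mul_norm_le_norm_sub_of_le_angle {W : Submodule ℝ R3} {x : R3} {θ : ℝ} (hθ : 0 ≤ θ)
    (hW : ∃ u ∈ W, u ≠ 0)
    (h : ∀ u ∈ W, u ≠ 0 → θ ≤ InnerProductGeometry.angle x u) {u : R3} (hu : u ∈ W) :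
    2 / Real.pi * θ * ‖x‖ ≤ ‖x - u‖ := by
  have hsin : ∀ u ∈ W, u ≠ 0 → 2 / Real.pi * θ ≤ Real.sin (InnerProductGeometry.angle x u) := by
    intro u hu hu0
    have h₁ := h u hu hu0
    have h₂ := h (-u) (W.neg_mem hu) (neg_ne_zero.2 hu0)
    rw [InnerProductGeometry.angle_neg_right] at h₂
    have hpi := Real.pi_pos
    rcases le_total (InnerProductGeometry.angle x u) (Real.pi / 2) with hle | hle
    · refine le_trans ?_ (Real.mul_le_sin (InnerProductGeometry.angle_nonneg _ _) hle)
      gcongr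
    · rw [← Real.sin_pi_sub]
      refine le_trans ?_ (Real.mul_le_sin (by linarith) (by linarith))
      gcongr
  by_cases hu0 : u = 0
  · obtain ⟨u', hu', hu'0⟩ := hW
    rw [hu0, sub_zero]
    refine mul_le_of_le_one_left (norm_nonneg x) ((hsin u' hu' hu'0).trans (Real.sin_le_one _))
  · refine (mul_le_mul_of_nonneg_right (hsin u hu hu0) (norm_nonneg x)).trans ?_
    refine abs_le_of_sq_le_sq' ?_ (norm_nonneg _) |>.2
    have h₁ := norm_sub_sq_real x u
    rw [← InnerProductGeometry.cos_angle_mul_norm_mul_norm x u] at h₁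
    rw [h₁, mul_pow, Real.sin_sq]
    nlinarith [sq_nonneg (‖u‖ - Real.cos (InnerProductGeometry.angle x u) * ‖x‖)]

lemma exists_axis_point {T : Tube} {σ : ℝ} {y : R3} (hy : y ∈ T.set σ) :
    ∃ u ∈ Icc (0 : ℝ) 1, ‖y - (T.p0 + u • T.dir)‖ < σ := by
  obtain ⟨z, hz, hyz⟩ := mem_thickening_iff.1 hy
  rw [segment_eq_image'] at hz
  obtain ⟨u, hu, rfl⟩ := hz
  exact ⟨u, hu, by rwa [dist_eq_norm] at hyz⟩

lemma axis_point_mem (T : Tube) {u : ℝ} (hu : u ∈ Icc (0 : ℝ) 1) :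
    T.p0 + u • T.dir ∈ segment ℝ T.p0 T.p1 := by
  rw [segment_eq_image']
  exact ⟨u, hu, rfl⟩

lemma dir_two (T : Tube) : T.dir 2 = 1 := by
  simp [Tube.dir, T.h0, T.h1]

lemma norm_dir_le (T : Tube) : ‖T.dir‖ ≤ 11 / 10 := by
  have hx := abs_le.1 T.hx
  have hy := abs_le.1 T.hy
  have h2 := dir_two T
  have : ‖T.dir‖ ^ 2 ≤ (11 / 10) ^ 2 := by
    rw [EuclideanSpace.norm_sq_eq, Fin.sum_univ_three]
    simp only [Real.norm_eq_abs, sq_abs]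
    rw [h2]
    change (T.p1 - T.p0) 0 ^ 2 + (T.p1 - T.p0) 1 ^ 2 + 1 ^ 2 ≤ _
    nlinarith
  exact (abs_le_of_sq_le_sq' this (by norm_num)).2

lemma one_le_norm_dir (T : Tube) : 1 ≤ ‖T.dir‖ := by
  have := PiLp.norm_apply_le T.dir 2
  rwa [dir_two, norm_one] at this

/-- Two directions of tubes are within a right angle of each other. -/
lemma four_fifths_le_inner_dir (T T' : Tube) : 4 / 5 ≤ ⟪T.dir, T'.dir⟫ := by
  have hx := abs_le.1 T.hx
  have hy := abs_le.1 T.hy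
  have hx' := abs_le.1 T'.hx
  have hy' := abs_le.1 T'.hy
  have h2 := dir_two T
  have h2' := dir_two T'
  rw [PiLp.inner_apply, Fin.sum_univ_three]
  simp only [RCLike.inner_apply, conj_trivial]
  rw [h2, h2']
  change _ ≤ (T'.p1 - T'.p0) 0 * (T.p1 - T.p0) 0 + (T'.p1 - T'.p0) 1 * (T.p1 - T.p0) 1 + 1 * 1
  nlinarith

lemma norm_dir_sub_dir_le {T T' : Tube} {δ ρ : ℝ} (hδ : 0 < δ) (h : T.set δ ⊆ T'.set ρ) :
    ‖T'.dir - T.dir‖ ≤ 5 * ρ := by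
  have hmem : ∀ p ∈ segment ℝ T.p0 T.p1, p ∈ T'.set ρ := fun p hp =>
    h (self_subset_thickening hδ _ hp)
  obtain ⟨u, hu, hu'⟩ := exists_axis_point (hmem T.p0 (left_mem_segment _ _ _))
  obtain ⟨v, hv, hv'⟩ := exists_axis_point (hmem T.p1 (right_mem_segment _ _ _))
  have hz := (PiLp.norm_apply_le (T.p0 - (T'.p0 + u • T'.dir)) 2).trans_lt hu'
  have hz' := (PiLp.norm_apply_le (T.p1 - (T'.p0 + v • T'.dir)) 2).trans_lt hv'
  simp only [PiLp.sub_apply, PiLp.add_apply, PiLp.smul_apply, T.h0, T.h1, T'.h0, dir_two,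
    Real.norm_eq_abs, smul_eq_mul] at hz hz'
  have hn := norm_dir_le T'
  have hn0 := norm_nonneg T'.dir
  have key : T'.dir - T.dir = (T.p0 - (T'.p0 + u • T'.dir)) - (T.p1 - (T'.p0 + v • T'.dir))
      + (1 - v + u) • T'.dir := by
    simp only [Tube.dir]
    module
  have habs : |1 - v + u| ≤ 2 * ρ := by
    rw [abs_lt] at hz hz'
    rw [abs_le]
    constructor <;> linarith
  have hρ : 0 < ρ := (norm_nonneg _).trans_lt hu'
  calc ‖T'.dir - T.dir‖ ≤ ‖T.p0 - (T'.p0 + u • T'.dir)‖ + ‖T.p1 - (T'.p0 + v • T'.dir)‖ +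
      ‖(1 - v + u) • T'.dir‖ := by
        rw [key]
        exact (norm_add_le _ _).trans (by gcongr; exact norm_sub_le _ _)
    _ ≤ ρ + ρ + 2 * ρ * (11 / 10) := by
        rw [norm_smul, Real.norm_eq_abs]
        gcongr
    _ ≤ 5 * ρ := by linarith

/-- Points of the tubes near `x₀`, translated along `τ v / 2` towards the middle of the tubes, stay
in a set comparable to the union of the dilated tubes. -/
lemma exists_translate_set {C₀ δ ρ τ : ℝ} (hC₀ : 1 ≤ C₀) (hδ : 0 < δ) (hρδ : ρ ^ 2 = δ)
    (hρ : 0 < ρ) (hρ' : C₀ * ρ ≤ 1 / 10) {x₀ : R3}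
    (hτ : (τ = 1 ∧ x₀ 2 ≤ 1 / 2) ∨ (τ = -1 ∧ 1 / 2 ≤ x₀ 2))
    {Tρ : Tube} {𝕋 : Set Tube} {v : R3} {K : ℝ≥0∞}
    (hsub : ∀ T ∈ 𝕋, T.set δ ⊆ Tρ.set ρ)
    (hK : volume (ball x₀ (2 * C₀ * ρ) ∩ ⋃ T ∈ 𝕋, T.set (C₀ * δ)) ≤ K)
    (hv : ‖v - ρ • Tρ.dir‖ ≤ C₀ * δ) :
    ∃ B : Set R3, MeasurableSet B ∧ volume B ≤ ENNReal.ofReal ((C₀ + 5) ^ 3) * K ∧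
      ∀ y ∈ (⋃ T ∈ 𝕋, T.set δ) ∩ ball x₀ (C₀ * ρ), ∀ s ∈ Icc (0 : ℝ) 1,
        y + s • ((τ / 2) • v) ∈ B := by
  set G : Set R3 := (⋃ T ∈ 𝕋, segment ℝ T.p0 T.p1) ∩ ball x₀ (2 * C₀ * ρ - δ) with hG
  have hρ10 : ρ ≤ 1 / 10 := by nlinarith
  have hδρ : δ ≤ ρ / 10 := by nlinarith
  refine ⟨thickening ((C₀ + 4) * δ) G, isOpen_thickening.measurableSet, ?_, ?_⟩
  · refine (volume_thickening_mul_le G hδ (by linarith)).trans ?_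
    rw [add_assoc, show (4 : ℝ) + 1 = 5 by norm_num]
    gcongr
    refine (measure_mono ?_).trans hK
    intro y hy
    obtain ⟨g, ⟨hg, hgx⟩, hyg⟩ := mem_thickening_iff.1 hy
    refine ⟨?_, ?_⟩
    · have := dist_triangle y g x₀
      rw [mem_ball] at hgx ⊢
      linarith
    · simp only [mem_iUnion] at hg ⊢
      obtain ⟨T, hT, hg⟩ := hg
      exact ⟨T, hT, mem_thickening_iff.2 ⟨g, hg, hyg.trans_le (by nlinarith)⟩⟩
  · rintro y ⟨hy, hyx⟩ s hs
    simp only [mem_iUnion] at hy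
    obtain ⟨T, hT, hyT⟩ := hy
    obtain ⟨u, hu, hyu⟩ := exists_axis_point hyT
    have hdir := norm_dir_sub_dir_le hδ (hsub T hT)
    have hn := norm_dir_le T
    rw [mem_ball, dist_eq_norm] at hyx
    have hτ1 : |τ| = 1 := by rcases hτ with ⟨h, -⟩ | ⟨h, -⟩ <;> simp [h]
    have hux : ‖T.p0 + u • T.dir - x₀‖ ≤ C₀ * ρ + δ := by
      have : T.p0 + u • T.dir - x₀ = (y - x₀) - (y - (T.p0 + u • T.dir)) := by abel
      rw [this]
      exact (norm_sub_le _ _).trans (by linarith)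
    have hz := (PiLp.norm_apply_le (T.p0 + u • T.dir - x₀) 2).trans hux
    simp only [PiLp.sub_apply, PiLp.add_apply, PiLp.smul_apply, T.h0, dir_two,
      Real.norm_eq_abs, smul_eq_mul] at hz
    rw [abs_le] at hz
    have hsρ : 0 ≤ s * ρ := mul_nonneg hs.1 hρ.le
    have hsρ' : s * ρ ≤ ρ := mul_le_of_le_one_left hρ.le hs.2
    have hu' : u + τ * (s * ρ / 2) ∈ Icc (0 : ℝ) 1 := by
      rcases hτ with ⟨h, h'⟩ | ⟨h, h'⟩ <;> rw [h] <;>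
        exact ⟨by linarith [hz.1, hz.2, hu.1, hu.2], by linarith [hz.1, hz.2, hu.1, hu.2]⟩
    refine mem_thickening_iff.2 ⟨T.p0 + (u + τ * (s * ρ / 2)) • T.dir, ⟨?_, ?_⟩, ?_⟩
    · simp only [mem_iUnion]
      exact ⟨T, hT, axis_point_mem T hu'⟩
    · rw [mem_ball, dist_eq_norm]
      have : T.p0 + (u + τ * (s * ρ / 2)) • T.dir - x₀ =
          (T.p0 + u • T.dir - x₀) + (τ * (s * ρ / 2)) • T.dir := by module
      rw [this]
      have hb : ‖(τ * (s * ρ / 2)) • T.dir‖ ≤ ρ / 2 * (11 / 10) := by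
        rw [norm_smul, Real.norm_eq_abs, abs_mul, hτ1, one_mul, abs_of_nonneg (by linarith)]
        gcongr
      have := norm_add_le (T.p0 + u • T.dir - x₀) ((τ * (s * ρ / 2)) • T.dir)
      nlinarith
    · rw [dist_eq_norm]
      have : y + s • ((τ / 2) • v) - (T.p0 + (u + τ * (s * ρ / 2)) • T.dir) =
          (y - (T.p0 + u • T.dir)) + (τ * (s / 2)) • ((v - ρ • Tρ.dir) +
            ρ • (Tρ.dir - T.dir)) := by module
      rw [this]
      refine (norm_add_le _ _).trans_lt ?_
      rw [norm_smul, Real.norm_eq_abs, abs_mul, hτ1, one_mul, abs_of_nonneg (by linarith [hs.1])]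
      have hin : ‖(v - ρ • Tρ.dir) + ρ • (Tρ.dir - T.dir)‖ ≤ C₀ * δ + 5 * δ := by
        refine (norm_add_le _ _).trans (add_le_add hv ?_)
        rw [norm_smul, Real.norm_eq_abs, abs_of_pos hρ]
        nlinarith
      have hs2 : s / 2 * ‖(v - ρ • Tρ.dir) + ρ • (Tρ.dir - T.dir)‖ ≤
          1 / 2 * (C₀ * δ + 5 * δ) := by
        refine mul_le_mul (by linarith [hs.2]) hin (norm_nonneg _) (by norm_num)
      nlinarith

lemma abs_mul_le_norm_smul_add_of_le_angle {W : Submodule ℝ R3} {x : R3} {θ : ℝ} (hθ : 0 ≤ θ)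
    (hW : ∃ u ∈ W, u ≠ 0) (h : ∀ u ∈ W, u ≠ 0 → θ ≤ InnerProductGeometry.angle x u)
    {u : R3} (hu : u ∈ W) (e : ℝ) : |e| * (3 / 5 * θ * ‖x‖) ≤ ‖e • x + u‖ := by
  rcases eq_or_ne e 0 with rfl | he
  · simp
  have hpi : 3 / 5 ≤ 2 / Real.pi := by
    rw [le_div_iff₀ Real.pi_pos]
    linarith [Real.pi_lt_d2]
  have := mul_norm_le_norm_sub_of_le_angle hθ hW h (W.smul_mem (-e⁻¹) hu)
  calc |e| * (3 / 5 * θ * ‖x‖) ≤ |e| * (2 / Real.pi * θ * ‖x‖) := by gcongr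
    _ ≤ |e| * ‖x - (-e⁻¹) • u‖ := by gcongr
    _ = ‖e • x + u‖ := by
      rw [← Real.norm_eq_abs, ← norm_smul, smul_sub, smul_smul, mul_neg, mul_inv_cancel₀ he]
      simp

lemma le_angle_of_mem_span_singleton {x y : R3} (hxy : 0 ≤ ⟪x, y⟫) {θ : ℝ}
    (hθ : θ ≤ InnerProductGeometry.angle x y) :
    ∀ u ∈ Submodule.span ℝ ({y} : Set R3), u ≠ 0 → θ ≤ InnerProductGeometry.angle x u := by
  intro u hu hu0
  obtain ⟨k, rfl⟩ := Submodule.mem_span_singleton.1 hu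
  rcases lt_trichotomy k 0 with hk | rfl | hk
  · rw [InnerProductGeometry.angle_smul_right_of_neg _ _ hk, InnerProductGeometry.angle_neg_right]
    have : InnerProductGeometry.angle x y ≤ Real.pi / 2 :=
      Real.arccos_le_pi_div_two.2 (by positivity)
    linarith [Real.pi_gt_three]
  · simp at hu0
  · rwa [InnerProductGeometry.angle_smul_right_of_pos _ _ hk]

/-- Quantitative linear independence of three nonplanar vectors of length about `ρ`. -/
lemma coefficient_bounds {ρ M : ℝ} (hρ : 0 < ρ) (hM : 1 < M) (hρM : ρ * M ^ 2 ≤ 1)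
    {v₁ v₂ v₃ : R3} (h₁ : 9 / 10 * ρ ≤ ‖v₁‖ ∧ ‖v₁‖ ≤ 6 / 5 * ρ)
    (h₂ : 9 / 10 * ρ ≤ ‖v₂‖ ∧ ‖v₂‖ ≤ 6 / 5 * ρ) (h₃ : 9 / 10 * ρ ≤ ‖v₃‖ ∧ ‖v₃‖ ≤ 6 / 5 * ρ)
    (hin : 0 ≤ ⟪v₁, v₂⟫) (hangle : M⁻¹ ≤ InnerProductGeometry.angle v₁ v₂)
    (hplane : ρ * M ^ 2 ≤ angleToPlane v₁ v₂ v₃) {a b e : ℝ}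
    (hsum : ‖a • v₁ + b • v₂ + e • v₃‖ < ρ ^ 2 * M / 20) :
    |a| ≤ 1 / 2 ∧ |b| ≤ 1 / 2 ∧ |e| * M ≤ 1 / 2 := by
  have hM0 : 0 < M := one_pos.trans hM
  have hne : ∀ {v : R3}, 9 / 10 * ρ ≤ ‖v‖ → v ≠ 0 := fun h => norm_pos_iff.1 (by linarith)
  have hsp : ∀ u ∈ Submodule.span ℝ ({v₁, v₂} : Set R3), u ≠ 0 →
      ρ * M ^ 2 ≤ InnerProductGeometry.angle v₃ u := fun u hu hu0 =>
    hplane.trans (csInf_le ⟨0, by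
      rintro _ ⟨u, -, -, rfl⟩
      exact InnerProductGeometry.angle_nonneg _ _⟩ ⟨u, hu, hu0, rfl⟩)
  have hmem₁ : v₁ ∈ Submodule.span ℝ ({v₁, v₂} : Set R3) := Submodule.subset_span (by simp)
  have hmem₂ : v₂ ∈ Submodule.span ℝ ({v₁, v₂} : Set R3) := Submodule.subset_span (by simp)
  have he : |e| * M ≤ 1 / 10 := by
    have hE := abs_mul_le_norm_smul_add_of_le_angle (by positivity) ⟨v₁, hmem₁, hne h₁.1⟩ hsp
      (add_mem (Submodule.smul_mem _ a hmem₁) (Submodule.smul_mem _ b hmem₂)) e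
    rw [add_comm (e • v₃)] at hE
    have hlow : |e| * (3 / 5 * (ρ * M ^ 2) * (9 / 10 * ρ)) ≤
        |e| * (3 / 5 * (ρ * M ^ 2) * ‖v₃‖) := by gcongr; exact h₃.1
    have hlt := hlow.trans (hE.trans hsum.le)
    have : (ρ ^ 2 * M) * (27 / 50 * (|e| * M)) ≤ (ρ ^ 2 * M) * (1 / 20) := by linarith
    have := le_of_mul_le_mul_left this (by positivity)
    linarith
  have hrest : ‖a • v₁ + b • v₂‖ * M ≤ 17 / 100 * ρ := by
    have h : ‖a • v₁ + b • v₂‖ ≤ ρ ^ 2 * M / 20 + |e| * (6 / 5 * ρ) := by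
      calc ‖a • v₁ + b • v₂‖ = ‖(a • v₁ + b • v₂ + e • v₃) - e • v₃‖ := by simp
        _ ≤ ‖a • v₁ + b • v₂ + e • v₃‖ + ‖e • v₃‖ := norm_sub_le _ _
        _ ≤ _ := by
          rw [norm_smul, Real.norm_eq_abs]
          gcongr
          exact h₃.2
    calc ‖a • v₁ + b • v₂‖ * M ≤ (ρ ^ 2 * M / 20 + |e| * (6 / 5 * ρ)) * M := by gcongr
      _ = ρ * ((ρ * M ^ 2) / 20 + 6 / 5 * (|e| * M)) := by ring
      _ ≤ ρ * (1 / 20 + 6 / 5 * (1 / 10)) := by gcongr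
      _ = 17 / 100 * ρ := by ring
  have hpair : ∀ {x y : R3} {s t : ℝ}, 9 / 10 * ρ ≤ ‖x‖ → 9 / 10 * ρ ≤ ‖y‖ → 0 ≤ ⟪x, y⟫ →
      M⁻¹ ≤ InnerProductGeometry.angle x y → ‖s • x + t • y‖ * M ≤ 17 / 100 * ρ →
      |s| ≤ 1 / 2 := by
    intro x y s t hx hy hxy hang hst
    have hE := abs_mul_le_norm_smul_add_of_le_angle (by positivity)
      ⟨y, Submodule.mem_span_singleton_self y, hne hy⟩
      (le_angle_of_mem_span_singleton hxy hang)
      (Submodule.smul_mem _ t (Submodule.mem_span_singleton_self y)) s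
    have hlow : |s| * (3 / 5 * M⁻¹ * (9 / 10 * ρ)) ≤ |s| * (3 / 5 * M⁻¹ * ‖x‖) := by gcongr
    have hmul := mul_le_mul_of_nonneg_right (hlow.trans hE) hM0.le
    have heq : |s| * (3 / 5 * M⁻¹ * (9 / 10 * ρ)) * M = ρ * (27 / 50 * |s|) := by
      field_simp
      ring
    have : ρ * (27 / 50 * |s|) ≤ ρ * (17 / 100) := by linarith
    have := le_of_mul_le_mul_left this hρ
    linarith
  refine ⟨hpair h₁.1 h₂.1 hin hangle hrest, hpair (t := a) h₂.1 h₁.1 ?_ ?_ ?_, he.trans (by norm_num)⟩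
  · rwa [real_inner_comm]
  · rwa [InnerProductGeometry.angle_comm]
  · rwa [add_comm]

lemma norm_bounds_of_close {ρ : ℝ} (hρ : 0 < ρ) {v : R3} {T : Tube}
    (hv : ‖v - ρ • T.dir‖ ≤ ρ / 10) : 9 / 10 * ρ ≤ ‖v‖ ∧ ‖v‖ ≤ 6 / 5 * ρ := by
  have hn : ‖ρ • T.dir‖ = ρ * ‖T.dir‖ := by rw [norm_smul, Real.norm_eq_abs, abs_of_pos hρ]
  have hup := norm_dir_le T
  have hlow := one_le_norm_dir T
  have h := abs_le.1 ((abs_norm_sub_norm_le v (ρ • T.dir)).trans hv)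
  rw [hn] at h
  constructor <;> nlinarith [h.1, h.2]

lemma inner_nonneg_of_close {ρ : ℝ} (hρ : 0 < ρ) {v v' : R3} {T T' : Tube}
    (hv : ‖v - ρ • T.dir‖ ≤ ρ / 10) (hv' : ‖v' - ρ • T'.dir‖ ≤ ρ / 10) : 0 ≤ ⟪v, v'⟫ := by
  have hexp : ⟪v, v'⟫ = ρ ^ 2 * ⟪T.dir, T'.dir⟫ + ⟪v - ρ • T.dir, v'⟫ +
      ρ * ⟪T.dir, v' - ρ • T'.dir⟫ := by
    simp only [inner_sub_left, inner_sub_right, real_inner_smul_left, real_inner_smul_right]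
    ring
  have h₁ : |⟪v - ρ • T.dir, v'⟫| ≤ ρ / 10 * (6 / 5 * ρ) :=
    (abs_real_inner_le_norm _ _).trans (by gcongr; exact (norm_bounds_of_close hρ hv').2)
  have h₂ : |⟪T.dir, v' - ρ • T'.dir⟫| ≤ 11 / 10 * (ρ / 10) :=
    (abs_real_inner_le_norm _ _).trans (by gcongr; exact norm_dir_le T)
  have h₃ := four_fifths_le_inner_dir T T'
  rw [hexp]
  nlinarith [abs_le.1 h₁, abs_le.1 h₂, mul_le_mul_of_nonneg_left h₃ (sq_nonneg ρ),
    mul_le_mul_of_nonneg_left (abs_le.1 h₂).1 hρ.le]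

/-- Triple intersections, nonplanar case (Lemma 7.2, first part). If the tube families
𝕋_i lie in ρ-tubes T_ρ^i through x₀ with |B(x₀,2C₀ρ) ∩ ⋃ C₀T| ≤ δ^{-C₀√ε} δ^{3-d} ρ^d,
v_i = ρ dir(T_ρ^i) + O(δ), the set F satisfies |F ∩ B(x,σ)| ≤ δ^{-√ε} δ^{3-d} σ^d for
x ∈ F and δ ≤ σ ≤ 1, and the directions v₁, v₂, v₃ are quantitatively nonplanar
(∠(v₁,v₂) ≥ M⁻¹ and ∠(π(v₁,v₂),v₃) ≥ ρM²), then
|A₁ ∩ A₂ ∩ A₃ ∩ F| ≤ A δ^{-C√ε} δ^{3-d} ρ^d M^{-c}. -/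
theorem triple_intersection_nonplanar (d C₀ : ℝ) (hd2 : 2 < d) (hd3 : d < 3)
    (hC₀ : 1 ≤ C₀) :
    ∃ A C c ε₀ : ℝ, 0 < A ∧ 0 < C ∧ 0 < c ∧ 0 < ε₀ ∧
      ∀ ε : ℝ, 0 < ε → ε < ε₀ →
        ∃ δ₀ : ℝ, 0 < δ₀ ∧ ∀ δ : ℝ, 0 < δ → δ < δ₀ →
          ∀ (x₀ : R3) (Tρ₁ Tρ₂ Tρ₃ : Tube) (𝕋₁ 𝕋₂ 𝕋₃ : Set Tube) (v₁ v₂ v₃ : R3)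
            (M : ℝ) (F : Set R3),
            x₀ ∈ Tρ₁.set (δ ^ (1/2 : ℝ)) → x₀ ∈ Tρ₂.set (δ ^ (1/2 : ℝ)) →
            x₀ ∈ Tρ₃.set (δ ^ (1/2 : ℝ)) →
            𝕋₁.Finite → 𝕋₂.Finite → 𝕋₃.Finite →
            (∀ T ∈ 𝕋₁, T.set δ ⊆ Tρ₁.set (δ ^ (1/2 : ℝ))) →
            (∀ T ∈ 𝕋₂, T.set δ ⊆ Tρ₂.set (δ ^ (1/2 : ℝ))) →
            (∀ T ∈ 𝕋₃, T.set δ ⊆ Tρ₃.set (δ ^ (1/2 : ℝ))) →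
            (volume (Metric.ball x₀ (2 * C₀ * δ ^ (1/2 : ℝ)) ∩ ⋃ T ∈ 𝕋₁, T.set (C₀ * δ)) ≤
              ENNReal.ofReal (δ ^ (-(C₀ * Real.sqrt ε)) * δ ^ (3 - d) * (δ ^ (1/2 : ℝ)) ^ d)) →
            (volume (Metric.ball x₀ (2 * C₀ * δ ^ (1/2 : ℝ)) ∩ ⋃ T ∈ 𝕋₂, T.set (C₀ * δ)) ≤
              ENNReal.ofReal (δ ^ (-(C₀ * Real.sqrt ε)) * δ ^ (3 - d) * (δ ^ (1/2 : ℝ)) ^ d)) →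
            (volume (Metric.ball x₀ (2 * C₀ * δ ^ (1/2 : ℝ)) ∩ ⋃ T ∈ 𝕋₃, T.set (C₀ * δ)) ≤
              ENNReal.ofReal (δ ^ (-(C₀ * Real.sqrt ε)) * δ ^ (3 - d) * (δ ^ (1/2 : ℝ)) ^ d)) →
            ‖v₁ - (δ ^ (1/2 : ℝ)) • Tρ₁.dir‖ ≤ C₀ * δ →
            ‖v₂ - (δ ^ (1/2 : ℝ)) • Tρ₂.dir‖ ≤ C₀ * δ →
            ‖v₃ - (δ ^ (1/2 : ℝ)) • Tρ₃.dir‖ ≤ C₀ * δ →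
            1 < M → M ≤ δ ^ (-(1/4) : ℝ) →
            (∀ x ∈ F, ∀ σ : ℝ, δ ≤ σ → σ ≤ 1 →
              volume (F ∩ Metric.ball x σ) ≤
                ENNReal.ofReal (δ ^ (-Real.sqrt ε) * δ ^ (3 - d) * σ ^ d)) →
            M⁻¹ ≤ InnerProductGeometry.angle v₁ v₂ →
            (δ ^ (1/2 : ℝ)) * M ^ 2 ≤ angleToPlane v₁ v₂ v₃ →
            volume (((⋃ T ∈ 𝕋₁, T.set δ) ∩ Metric.ball x₀ (C₀ * δ ^ (1/2 : ℝ))) ∩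
                ((⋃ T ∈ 𝕋₂, T.set δ) ∩ Metric.ball x₀ (C₀ * δ ^ (1/2 : ℝ))) ∩
                ((⋃ T ∈ 𝕋₃, T.set δ) ∩ Metric.ball x₀ (C₀ * δ ^ (1/2 : ℝ))) ∩ F) ≤
              ENNReal.ofReal (A * δ ^ (-(C * Real.sqrt ε)) * δ ^ (3 - d) *
                (δ ^ (1/2 : ℝ)) ^ d * M ^ (-c)) := by
  refine ⟨300 * (C₀ + 5) ^ 3, C₀ + 1 / 3, (3 - d) / 3, 1, by positivity, by positivity,
    by linarith, one_pos, fun ε hε _ => ⟨1 / (100 * C₀ ^ 2), by positivity, ?_⟩⟩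
  intro δ hδ hδ₀ x₀ Tρ₁ Tρ₂ Tρ₃ 𝕋₁ 𝕋₂ 𝕋₃ v₁ v₂ v₃ M F _ _ _ _ _ _ hs₁ hs₂ hs₃ hK₁ hK₂ hK₃
    hv₁ hv₂ hv₃ hM hMδ hF hangle hplane
  have hρ2 : (δ ^ (1 / 2 : ℝ)) ^ 2 = δ := by
    rw [← Real.rpow_natCast, ← Real.rpow_mul hδ.le]
    norm_num
  have hρ : 0 < δ ^ (1 / 2 : ℝ) := Real.rpow_pos_of_pos hδ _
  have hρM : δ ^ (1 / 2 : ℝ) * M ^ 2 ≤ 1 := by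
    have : M ^ 2 ≤ δ ^ (-(1 / 2) : ℝ) := by
      calc M ^ 2 ≤ (δ ^ (-(1 / 4) : ℝ)) ^ 2 := by gcongr
        _ = δ ^ (-(1 / 2) : ℝ) := by
          rw [← Real.rpow_natCast, ← Real.rpow_mul hδ.le]
          norm_num
    calc δ ^ (1 / 2 : ℝ) * M ^ 2 ≤ δ ^ (1 / 2 : ℝ) * δ ^ (-(1 / 2) : ℝ) := by gcongr
      _ = 1 := by rw [← Real.rpow_add hδ]; norm_num
  set K : ℝ := δ ^ (-(C₀ * Real.sqrt ε)) * δ ^ (3 - d) * (δ ^ (1 / 2 : ℝ)) ^ d with hK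
  set ρ : ℝ := δ ^ (1 / 2 : ℝ)
  have hC₀ρ : C₀ * ρ ≤ 1 / 10 := by
    refine abs_le_of_sq_le_sq' (?_ : (C₀ * ρ) ^ 2 ≤ (1 / 10) ^ 2) (by norm_num) |>.2
    rw [mul_pow, hρ2]
    rw [lt_div_iff₀ (by positivity)] at hδ₀
    linarith
  obtain ⟨τ, hτ⟩ : ∃ τ : ℝ, (τ = 1 ∧ x₀ 2 ≤ 1 / 2) ∨ (τ = -1 ∧ 1 / 2 ≤ x₀ 2) := by
    rcases le_total (x₀ 2) (1 / 2) with h | h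
    · exact ⟨1, Or.inl ⟨rfl, h⟩⟩
    · exact ⟨-1, Or.inr ⟨rfl, h⟩⟩
  have hτ1 : |τ| = 1 := by rcases hτ with ⟨h, -⟩ | ⟨h, -⟩ <;> simp [h]
  obtain ⟨B₁, hB₁, hB₁K, hB₁s⟩ := exists_translate_set hC₀ hδ hρ2 hρ hC₀ρ hτ hs₁ hK₁ hv₁
  obtain ⟨B₂, hB₂, hB₂K, hB₂s⟩ := exists_translate_set hC₀ hδ hρ2 hρ hC₀ρ hτ hs₂ hK₂ hv₂
  obtain ⟨B₃, hB₃, hB₃K, hB₃s⟩ := exists_translate_set hC₀ hδ hρ2 hρ hC₀ρ hτ hs₃ hK₃ hv₃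
  set O : Set R3 := ((⋃ T ∈ 𝕋₁, T.set δ) ∩ ball x₀ (C₀ * ρ)) ∩
    ((⋃ T ∈ 𝕋₂, T.set δ) ∩ ball x₀ (C₀ * ρ)) ∩ ((⋃ T ∈ 𝕋₃, T.set δ) ∩ ball x₀ (C₀ * ρ)) with hO
  have hopen : ∀ 𝕋 : Set Tube, IsOpen ((⋃ T ∈ 𝕋, T.set δ) ∩ ball x₀ (C₀ * ρ)) := fun 𝕋 =>
    (isOpen_biUnion fun _ _ => isOpen_thickening).inter isOpen_ball
  have hOm : MeasurableSet O :=
    (((hopen 𝕋₁).inter (hopen 𝕋₂)).inter (hopen 𝕋₃)).measurableSet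
  have hM0 : 0 < M := one_pos.trans hM
  have hσ : 0 < δ * M / 20 := by positivity
  set X : ℝ := δ ^ (-Real.sqrt ε) * M ^ (d - 3) with hX
  have hX0 : 0 < X := mul_pos (Real.rpow_pos_of_pos hδ _) (Real.rpow_pos_of_pos hM0 _)
  set h : ℝ := 100 * (δ ^ (-(1 / 3 * Real.sqrt ε)) * M ^ (-((3 - d) / 3))) with hh
  have hh0 : 0 < h := by
    have := Real.rpow_pos_of_pos hδ (-(1 / 3 * Real.sqrt ε))
    have := Real.rpow_pos_of_pos hM0 (-((3 - d) / 3))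
    positivity
  have hh3 : h ^ 3 = 1000000 * X := by
    rw [hh, hX, mul_pow, mul_pow, ← Real.rpow_natCast (δ ^ _), ← Real.rpow_natCast (M ^ _),
      ← Real.rpow_mul hδ.le, ← Real.rpow_mul hM0.le,
      show -(1 / 3 * Real.sqrt ε) * ((3 : ℕ) : ℝ) = -Real.sqrt ε by push_cast; ring,
      show -((3 - d) / 3) * ((3 : ℕ) : ℝ) = d - 3 by push_cast; ring]
    norm_num
  have hdens : ∀ z, volume ((O ∩ toMeasurable volume F) ∩ ball z (δ * M / 20)) ≤
      ENNReal.ofReal (8000 * X) * volume (ball (0 : R3) (δ * M / 20)) := by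
    intro z
    have h₁ : volume ((O ∩ toMeasurable volume F) ∩ ball z (δ * M / 20)) ≤
        volume (F ∩ ball z (δ * M / 20)) := by
      rw [← Measure.measure_toMeasurable_inter_of_sFinite measurableSet_ball F]
      exact measure_mono (inter_subset_inter_left _ inter_subset_right)
    refine h₁.trans ?_
    rcases eq_empty_or_nonempty (F ∩ ball z (δ * M / 20)) with he | ⟨x, hxF, hxz⟩
    · rw [he, measure_empty]
      exact zero_le
    have hδM : δ * M ≤ 1 := by
      rw [← hρ2]
      nlinarith
    calc volume (F ∩ ball z (δ * M / 20)) ≤ volume (F ∩ ball x (δ * M)) := by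
          refine measure_mono (inter_subset_inter_right _ (ball_subset_ball' ?_))
          rw [mem_ball, dist_comm] at hxz
          linarith
      _ ≤ ENNReal.ofReal (δ ^ (-Real.sqrt ε) * δ ^ (3 - d) * (δ * M) ^ d) :=
          hF x hxF _ (by nlinarith) hδM
      _ = ENNReal.ofReal (8000 * X * (δ * M / 20) ^ 3) := by
          congr 1
          have e₁ : δ ^ (3 - d) * δ ^ d = δ ^ 3 := by
            rw [← Real.rpow_add hδ, ← Real.rpow_natCast]
            norm_num
          have e₂ : M ^ (d - 3) * M ^ 3 = M ^ d := by
            rw [← Real.rpow_natCast, ← Real.rpow_add hM0]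
            norm_num
          rw [Real.mul_rpow hδ.le hM0.le, hX, ← e₂]
          linear_combination δ ^ (-Real.sqrt ε) * M ^ (d - 3) * M ^ 3 * e₁
      _ ≤ _ := by
          rw [ENNReal.ofReal_mul (by positivity), EuclideanSpace.volume_ball_fin_three]
          rw [ENNReal.ofReal_pow hσ.le]
          gcongr
          refine le_mul_of_one_le_right zero_le ?_
          rw [ENNReal.one_le_ofReal]
          linarith [Real.pi_gt_three]
  have hmain := volume_le_of_three_directions (S := O ∩ toMeasurable volume F)
    (hOm.inter (measurableSet_toMeasurable _ _)) hB₁ hB₂ hB₃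
    (w₁ := (τ / 2) • v₁) (w₂ := (τ / 2) • v₂) (w₃ := M⁻¹ • ((τ / 2) • v₃))
    (fun y hy => hB₁s y hy.1.1.1) (fun y hy => hB₂s y hy.1.1.2)
    (fun y hy s hs => by
      rw [smul_smul]
      refine hB₃s y hy.1.2 _ ⟨mul_nonneg hs.1 (inv_nonneg.2 hM0.le), ?_⟩
      exact mul_le_one₀ hs.2 (inv_nonneg.2 hM0.le) (inv_le_one_of_one_le₀ hM.le))
    hσ hdens (η := ENNReal.ofReal h) ?_ hB₁K hB₂K hB₃K ?_
  · refine (measure_mono (inter_subset_inter_right _ (subset_toMeasurable volume F))).trans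
      (hmain.trans (le_of_eq ?_))
    rw [show (3 : ℝ≥0∞) = ENNReal.ofReal 3 by norm_num, ← ENNReal.ofReal_mul (by norm_num),
      ← ENNReal.ofReal_mul (by positivity), ← ENNReal.ofReal_mul (by positivity)]
    congr 1
    rw [hh, hK, show -((C₀ + 1 / 3) * Real.sqrt ε) =
      -(1 / 3 * Real.sqrt ε) + -(C₀ * Real.sqrt ε) by ring, Real.rpow_add hδ]
    ring
  · intro a b e habe
    have hsum : a • ((τ / 2) • v₁) + b • ((τ / 2) • v₂) + e • (M⁻¹ • ((τ / 2) • v₃)) =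
        (a * (τ / 2)) • v₁ + (b * (τ / 2)) • v₂ + (e * (M⁻¹ * (τ / 2))) • v₃ := by module
    rw [hsum] at habe
    have hclose : ∀ {v : R3} {T : Tube}, ‖v - ρ • T.dir‖ ≤ C₀ * δ →
        ‖v - ρ • T.dir‖ ≤ ρ / 10 := fun hv => hv.trans (by rw [← hρ2]; nlinarith)
    obtain ⟨h₁, h₂, h₃⟩ := coefficient_bounds hρ hM hρM (norm_bounds_of_close hρ (hclose hv₁))
      (norm_bounds_of_close hρ (hclose hv₂)) (norm_bounds_of_close hρ (hclose hv₃))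
      (inner_nonneg_of_close hρ (hclose hv₁) (hclose hv₂)) hangle hplane
      (habe.trans_eq (by rw [← hρ2]))
    rw [abs_mul, abs_div, hτ1, abs_two] at h₁ h₂
    rw [abs_mul, abs_mul, abs_div, hτ1, abs_two, abs_of_pos (inv_pos.2 hM0)] at h₃
    refine ⟨by linarith, by linarith, ?_⟩
    have : |e| * (M⁻¹ * (1 / 2)) * M = |e| / 2 := by field_simp
    linarith
  · rw [← ENNReal.ofReal_pow hh0.le, hh3,
      show (64 : ℝ≥0∞) = ENNReal.ofReal 64 by norm_num, ← ENNReal.ofReal_mul (by norm_num)]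
    exact (ENNReal.ofReal_lt_ofReal_iff (by positivity)).2 (by linarith)

end
end

section
/- (Strengthened functional relationship.) Let C₀ > 0. There exist constants A, C (depending only on C₀) such that the following holds for all sufficiently small ε > 0 and all sufficiently large M. Let Ω ⊆ ℤ⁴ (coordinates (x₀, y₀, x₂, y₂)) with coordinate projections X₀, Y₀, X₂, Y₂ ⊆ ℤ satisfy: #Ω ≥ M^{−C₀√ε} M²; #X₀ ≤ M^{C₀√ε} M, #Y₀ ≤ M^{C₀√ε} M^{1/2}, #X₂ ≤ M^{C₀√ε} M^{1/2}, #Y₂ ≤ M^{C₀√ε} M; #{(x₂+y₀)+(x₀+y₂) : (x₀,y₀,x₂,y₂) ∈ Ω} ≤ M^{C₀√ε} M^{1/2}; there exist functions g : X₀ × Y₀ → Y₂ and h : X₂ × Y₂ → X₀ with y₂ = g(x₀,y₀) and x₀ = h(x₂,y₂) on Ω; and #{(x₀,y₀,x₂,y₂) ∈ Ω : (x₂+y₀)−(x₀+y₂) = w} ≤ M^{C₀√ε} M for all w ∈ ℤ. Then there exists Ω₁ ⊆ Ω with #Ω₁ ≥ A^{-1} M^{−C√ε} M² and functions g̃ :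 X₀ → Y₂ and h̃ : Y₂ → X₀ such that y₂ = g̃(x₀) and x₀ = h̃(y₂) for all (x₀,y₀,x₂,y₂) ∈ Ω₁. Consequently, setting f(y₂) = y₂ + h̃(y₂), one has #{(x₂+y₀)+f(y₂) : (x₀,y₀,x₂,y₂) ∈ Ω₁} ≤ A M^{C√ε} M^{1/2} and, for every w ∈ ℤ, #{(x₀,y₀,x₂,y₂) ∈ Ω₁ : (x₂+y₀)−f(y₂) = w} ≤ A M^{C√ε} M. -/
/-- Suppose that on a finite set `Ω` the coordinate `q` is a function of `(p, b)`, the coordinate `p`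
is a function `h` of `(c, q)`, and `(p, q, b, c)` is injective. Then freezing the first argument of
`h` at a suitable value `c'` gives a relation `p = h c' q` that holds on a large part of `Ω`. -/
theorem exists_card_sq_le_mul_card_filter {α X Y B C : Type*} [DecidableEq X] [DecidableEq B]
    [DecidableEq C] [Nonempty C] (Ω : Finset α) (p : α → X) (q : α → Y) (b : α → B) (c : α → C)
    (g : X → B → Y) (h : C → Y → X)
    (hq : ∀ ω ∈ Ω, q ω = g (p ω) (b ω)) (hp : ∀ ω ∈ Ω, p ω = h (c ω) (q ω))
    (hinj : ∀ ω ∈ Ω, ∀ ω' ∈ Ω, p ω = p ω' → q ω = q ω' → b ω = b ω' → c ω = c ω' → ω = ω') :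
    ∃ c' : C, Ω.card ^ 2 ≤ (Ω.image p).card * (Ω.image b).card * (Ω.image c).card *
      (Ω.filter fun ω => p ω = h c' (q ω)).card := by
  classical
  rcases Ω.eq_empty_or_nonempty with rfl | hne
  · exact ⟨Classical.arbitrary C, by simp⟩
  let fiber : X × B → Finset α := fun z => Ω.filter fun ω => (p ω, b ω) = z
  have cauchy_schwarz : Ω.card ^ 2 ≤
      (Ω.image p).card * (Ω.image b).card *
        ∑ z ∈ Ω.image p ×ˢ Ω.image b, (fiber z).card ^ 2 := by
    have hmaps : ∀ ω ∈ Ω, (p ω, b ω) ∈ Ω.image p ×ˢ Ω.image b := fun ω hω =>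
      Finset.mem_product.2 ⟨Finset.mem_image_of_mem p hω, Finset.mem_image_of_mem b hω⟩
    rw [Finset.card_eq_sum_card_fiberwise hmaps, ← Finset.card_product]
    exact sq_sum_le_card_mul_sum_sq
  have fiber_sq (z : X × B) : (fiber z).card ^ 2 ≤
      ∑ ω ∈ fiber z, ((Ω.image c).filter fun c' => p ω = h c' (q ω)).card := by
    rw [sq, ← smul_eq_mul]
    refine Finset.card_nsmul_le_sum _ _ _ fun ω hω => ?_
    obtain ⟨hω, hz⟩ := Finset.mem_filter.1 hω
    have key : ∀ ω' ∈ fiber z, ω' ∈ Ω ∧ p ω' = p ω ∧ b ω' = b ω ∧ q ω' = q ω := by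
      intro ω' hω'
      obtain ⟨hω', hz'⟩ := Finset.mem_filter.1 hω'
      obtain ⟨h1, h2⟩ := Prod.mk.inj (hz'.trans hz.symm)
      exact ⟨hω', h1, h2, by rw [hq ω' hω', hq ω hω, h1, h2]⟩
    refine Finset.card_le_card_of_injOn c (fun ω' hω' => ?_) fun ω₁ h₁ ω₂ h₂ hc => ?_
    · obtain ⟨hm, h1, -, h3⟩ := key ω' hω'
      refine Finset.mem_coe.2 (Finset.mem_filter.2 ⟨Finset.mem_image_of_mem c hm, ?_⟩)
      rw [← h1, ← h3]
      exact hp ω' hm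
    · obtain ⟨hm₁, p₁, b₁, q₁⟩ := key ω₁ h₁
      obtain ⟨hm₂, p₂, b₂, q₂⟩ := key ω₂ h₂
      exact hinj _ hm₁ _ hm₂ (p₁.trans p₂.symm) (q₁.trans q₂.symm) (b₁.trans b₂.symm) hc
  have sum_fiber_sq : ∑ z ∈ Ω.image p ×ˢ Ω.image b, (fiber z).card ^ 2 ≤
      ∑ c' ∈ Ω.image c, (Ω.filter fun ω => p ω = h c' (q ω)).card := by
    refine (Finset.sum_le_sum fun z _ => fiber_sq z).trans ?_
    rw [Finset.sum_fiberwise_of_maps_to fun ω hω =>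
      Finset.mem_product.2 ⟨Finset.mem_image_of_mem p hω, Finset.mem_image_of_mem b hω⟩]
    simp only [Finset.card_filter]
    rw [Finset.sum_comm]
  obtain ⟨c', -, hmax⟩ := (Ω.image c).exists_max_image
    (fun c' => (Ω.filter fun ω => p ω = h c' (q ω)).card) (hne.image c)
  refine ⟨c', cauchy_schwarz.trans ?_⟩
  rw [mul_assoc (_ * _)]
  refine Nat.mul_le_mul_left _ (sum_fiber_sq.trans ?_)
  rw [← smul_eq_mul]
  exact Finset.sum_le_card_nsmul _ _ _ hmax

/-- The numerical form of one pigeonholing step: if `n² ≤ abc · m` with `n` of order at least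
`R⁻¹ M²` and `abc` of order at most `T³ M²`, then `m` has order at least `R⁻² T⁻³ M²`. -/
theorem inv_mul_sq_le_of_sq_le {M T R n m a b c : ℝ} (hM : 0 < M) (hT : 0 < T) (hR : 0 < R)
    (hb : 0 ≤ b) (hc : 0 ≤ c) (hm : 0 ≤ m)
    (hn : R⁻¹ * M ^ 2 ≤ n) (haM : a ≤ T * M) (hbM : b ≤ T * M ^ ((1 : ℝ) / 2))
    (hcM : c ≤ T * M ^ ((1 : ℝ) / 2)) (h : n ^ 2 ≤ a * b * c * m) :
    (R ^ 2 * T ^ 3)⁻¹ * M ^ 2 ≤ m := by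
  have hhalf : M ^ ((1 : ℝ) / 2) * M ^ ((1 : ℝ) / 2) = M := by
    rw [← Real.rpow_add hM]; norm_num
  have habc : a * b * c ≤ T ^ 3 * M ^ 2 := by
    calc a * b * c ≤ T * M * (T * M ^ ((1 : ℝ) / 2)) * (T * M ^ ((1 : ℝ) / 2)) := by gcongr
      _ = T ^ 3 * M * (M ^ ((1 : ℝ) / 2) * M ^ ((1 : ℝ) / 2)) := by ring
      _ = T ^ 3 * M ^ 2 := by rw [hhalf]; ring
  have hsq : (R⁻¹ * M ^ 2) ^ 2 ≤ T ^ 3 * M ^ 2 * m :=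
    (pow_le_pow_left₀ (by positivity) hn 2).trans
      (h.trans (mul_le_mul_of_nonneg_right habc hm))
  refine le_of_mul_le_mul_left ?_ (by positivity : 0 < T ^ 3 * M ^ 2)
  refine le_trans (le_of_eq ?_) hsq
  field_simp

/-- Strengthened functional relationship (Proposition 12.1, d = 5/2 case): given the
additive model Ω ⊆ ℤ⁴ of a near-extremal Besicovitch set with the graininess bounds,
the partial functional relationships y₂ = g(x₀,y₀) and x₀ = h(x₂,y₂), and the
direction-separation bound, one can pass to a subset Ω₁ of comparable size on which
there is a direct functional relationship y₂ = g̃(x₀), x₀ = h̃(y₂); consequently, with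
f(y₂) = y₂ + h̃(y₂), the sums (x₂+y₀)+f(y₂) take few values and each value of
(x₂+y₀)−f(y₂) is attained at most ≲ M^{C√ε} M times. -/
theorem strengthened_functional_relationship (C₀ : ℝ) (hC₀ : 0 < C₀) :
    ∃ A C ε₀ : ℝ, 0 < A ∧ 0 < C ∧ 0 < ε₀ ∧
      ∀ ε : ℝ, 0 < ε → ε < ε₀ →
        ∃ M₀ : ℝ, ∀ M : ℝ, M₀ ≤ M →
          ∀ (Ω : Finset (ℤ × ℤ × ℤ × ℤ)) (g h : ℤ → ℤ → ℤ),
            M ^ (-(C₀ * Real.sqrt ε)) * M ^ 2 ≤ (Ω.card : ℝ) →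
            ((Ω.image fun p => p.1).card : ℝ) ≤ M ^ (C₀ * Real.sqrt ε) * M →
            ((Ω.image fun p => p.2.1).card : ℝ) ≤
              M ^ (C₀ * Real.sqrt ε) * M ^ ((1 : ℝ) / 2) →
            ((Ω.image fun p => p.2.2.1).card : ℝ) ≤
              M ^ (C₀ * Real.sqrt ε) * M ^ ((1 : ℝ) / 2) →
            ((Ω.image fun p => p.2.2.2).card : ℝ) ≤ M ^ (C₀ * Real.sqrt ε) * M →
            ((Ω.image fun p => (p.2.2.1 + p.2.1) + (p.1 + p.2.2.2)).card : ℝ) ≤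
              M ^ (C₀ * Real.sqrt ε) * M ^ ((1 : ℝ) / 2) →
            (∀ p ∈ Ω, p.2.2.2 = g p.1 p.2.1 ∧ p.1 = h p.2.2.1 p.2.2.2) →
            (∀ w : ℤ,
              ((Ω.filter fun p => (p.2.2.1 + p.2.1) - (p.1 + p.2.2.2) = w).card : ℝ) ≤
                M ^ (C₀ * Real.sqrt ε) * M) →
            ∃ Ω₁ : Finset (ℤ × ℤ × ℤ × ℤ), Ω₁ ⊆ Ω ∧
              A⁻¹ * M ^ (-(C * Real.sqrt ε)) * M ^ 2 ≤ (Ω₁.card : ℝ) ∧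
              ∃ gt ht : ℤ → ℤ,
                (∀ p ∈ Ω₁, p.2.2.2 = gt p.1 ∧ p.1 = ht p.2.2.2) ∧
                ((Ω₁.image fun p =>
                    (p.2.2.1 + p.2.1) + (p.2.2.2 + ht p.2.2.2)).card : ℝ) ≤
                  A * M ^ (C * Real.sqrt ε) * M ^ ((1 : ℝ) / 2) ∧
                ∀ w : ℤ,
                  ((Ω₁.filter fun p =>
                      (p.2.2.1 + p.2.1) - (p.2.2.2 + ht p.2.2.2) = w).card : ℝ) ≤
                    A * M ^ (C * Real.sqrt ε) * M := by
  refine ⟨1, 13 * C₀, 1, one_pos, by positivity, one_pos, fun ε _ _ => ⟨1, ?_⟩⟩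
  intro M hM Ω g h hΩ hX₀ hY₀ hX₂ hY₂ hW hgh hV
  have hM0 : 0 < M := one_pos.trans_le hM
  have hTpow : M ^ (13 * C₀ * Real.sqrt ε) = (M ^ (C₀ * Real.sqrt ε)) ^ 13 := by
    rw [← Real.rpow_mul_natCast hM0.le]; congr 1; push_cast; ring
  have hT1 : 1 ≤ M ^ (C₀ * Real.sqrt ε) := Real.one_le_rpow hM (by positivity)
  rw [Real.rpow_neg hM0.le] at hΩ
  rw [Real.rpow_neg hM0.le, hTpow]
  generalize M ^ (C₀ * Real.sqrt ε) = T at *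
  have hT0 : 0 < T := one_pos.trans_le hT1
  have hTle : T ≤ T ^ 13 := le_self_pow₀ hT1 (by norm_num)
  obtain ⟨x, hx⟩ := exists_card_sq_le_mul_card_filter Ω (fun p => p.1) (fun p => p.2.2.2)
    (fun p => p.2.1) (fun p => p.2.2.1) g h (fun p hp => (hgh p hp).1)
    (fun p hp => (hgh p hp).2)
    (fun p _ p' _ h1 h2 h3 h4 => Prod.ext h1 (Prod.ext h3 (Prod.ext h4 h2)))
  set Ω' := Ω.filter fun p => p.1 = h x p.2.2.2
  have hΩ' : Ω' ⊆ Ω := Finset.filter_subset _ _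
  obtain ⟨y, hy⟩ := exists_card_sq_le_mul_card_filter Ω' (fun p => p.2.2.2) (fun p => p.1)
    (fun p => p.2.2.1) (fun p => p.2.1) (fun u v => h v u) (fun u v => g v u)
    (fun p hp => (hgh p (hΩ' hp)).2) (fun p hp => (hgh p (hΩ' hp)).1)
    (fun p _ p' _ h1 h2 h3 h4 => Prod.ext h2 (Prod.ext h4 (Prod.ext h3 h1)))
  set Ω₁ := Ω'.filter fun p => p.2.2.2 = g p.1 y
  have hΩ₁ : Ω₁ ⊆ Ω := (Finset.filter_subset _ _).trans hΩ'
  have hΩ'card : (T ^ 2 * T ^ 3)⁻¹ * M ^ 2 ≤ (Ω'.card : ℝ) :=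
    inv_mul_sq_le_of_sq_le hM0 hT0 hT0 (Nat.cast_nonneg _) (Nat.cast_nonneg _)
      (Nat.cast_nonneg _) hΩ hX₀ hY₀ hX₂ (by exact_mod_cast hx)
  have image_le {f : ℤ × ℤ × ℤ × ℤ → ℤ} {r : ℝ} (hf : ((Ω.image f).card : ℝ) ≤ r) :
      ((Ω'.image f).card : ℝ) ≤ r :=
    le_trans (by exact_mod_cast Finset.card_le_card (Finset.image_subset_image hΩ')) hf
  have hΩ₁card : ((T ^ 2 * T ^ 3) ^ 2 * T ^ 3)⁻¹ * M ^ 2 ≤ (Ω₁.card : ℝ) :=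
    inv_mul_sq_le_of_sq_le hM0 hT0 (by positivity) (Nat.cast_nonneg _) (Nat.cast_nonneg _)
      (Nat.cast_nonneg _) hΩ'card (image_le hY₂) (image_le hX₂) (image_le hY₀)
      (by exact_mod_cast hy)
  have hht : ∀ p ∈ Ω₁, p.1 = h x p.2.2.2 := fun p hp =>
    (Finset.mem_filter.1 (Finset.mem_filter.1 hp).1).2
  refine ⟨Ω₁, hΩ₁, ?_, fun u => g u y, h x,
    fun p hp => ⟨(Finset.mem_filter.1 hp).2, hht p hp⟩, ?_, fun w => ?_⟩
  · convert hΩ₁card using 2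
    rw [inv_one, one_mul]
    ring
  · have hsub : (Ω₁.image fun p => (p.2.2.1 + p.2.1) + (p.2.2.2 + h x p.2.2.2)) ⊆
        Ω.image fun p => (p.2.2.1 + p.2.1) + (p.1 + p.2.2.2) := by
      intro s hs
      obtain ⟨p, hp, rfl⟩ := Finset.mem_image.1 hs
      refine Finset.mem_image.2 ⟨p, hΩ₁ hp, ?_⟩
      rw [← hht p hp, add_comm p.1]
    calc _ ≤ _ := Nat.cast_le.2 (Finset.card_le_card hsub)
      _ ≤ T * M ^ ((1 : ℝ) / 2) := hW
      _ ≤ 1 * T ^ 13 * M ^ ((1 : ℝ) / 2) := by rw [one_mul]; gcongr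
  · have hsub : (Ω₁.filter fun p => (p.2.2.1 + p.2.1) - (p.2.2.2 + h x p.2.2.2) = w) ⊆
        Ω.filter fun p => (p.2.2.1 + p.2.1) - (p.1 + p.2.2.2) = w := by
      intro p hp
      obtain ⟨hp, hw⟩ := Finset.mem_filter.1 hp
      rw [← hht p hp, add_comm p.2.2.2] at hw
      exact Finset.mem_filter.2 ⟨hΩ₁ hp, hw⟩
    calc _ ≤ _ := Nat.cast_le.2 (Finset.card_le_card hsub)
      _ ≤ T * M := hV w
      _ ≤ 1 * T ^ 13 * M := by rw [one_mul]; gcongr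
end

section
/- (Refinement with few sums.) Let C₀ > 0. There exist constants A, C (depending only on C₀) such that the following holds for all sufficiently small ε > 0 and all sufficiently large M. Let Ω₁ ⊆ ℤ⁴ (coordinates (x₀, y₀, x₂, y₂)) with coordinate projections X₀, Y₀, X₂, Y₂ ⊆ ℤ satisfy: #Ω₁ ≥ M^{−C₀√ε} M²; #X₀ ≤ M^{C₀√ε} M, #Y₀ ≤ M^{C₀√ε} M^{1/2}, #X₂ ≤ M^{C₀√ε} M^{1/2}, #Y₂ ≤ M^{C₀√ε} M; there is a function h̃ : Y₂ → X₀ with x₀ = h̃(y₂) for all (x₀,y₀,x₂,y₂) ∈ Ω₁; and, with f(y₂) = y₂ + h̃(y₂), #{(x₂+y₀)+f(y₂) : (x₀,y₀,x₂,y₂) ∈ Ω₁} ≤ M^{C₀√ε} M^{1/2}. Then there exists Ω₂ ⊆ Ω₁ with #Ω₂ ≥ A^{-1} M^{−C√ε} M² such that the sets A' = {x₂ + y₀ : (x₀,y₀,x₂,y₂) ∈ Ω₂} and B' = {f(y₂) : (x₀,y₀,x₂,y₂) ∈ Ω₂} satisfy #A' ≤ A M^{C√ε} M^{1/2} and #B'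 ≤ A M^{C√ε} M^{1/2}. -/
open Finset in
/-- The number of pairs of elements of `s` in a common fibre of `v` is at least
the square of the size of `s` divided by the number of values of `v` on `s`. -/
theorem Finset.sq_card_le_card_image_mul_card_fibre_pairs {α γ : Type*} [DecidableEq γ]
    (s : Finset α) (v : α → γ) :
    s.card ^ 2 ≤ (s.image v).card * ((s ×ˢ s).filter fun x => v x.1 = v x.2).card := by
  have hpairs : ((s ×ˢ s).filter fun x => v x.1 = v x.2).card =
      ∑ c ∈ s.image v, (s.filter fun p => v p = c).card ^ 2 := by
    rw [card_eq_sum_card_fiberwise (f := fun x => v x.1) (t := s.image v)]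
    · refine sum_congr rfl fun c _ => ?_
      rw [sq, ← card_product]
      congr 1
      ext x
      simp only [mem_filter, mem_product]
      grind
    · intro x hx
      simp only [coe_filter, mem_product, Set.mem_ofPred_eq] at hx
      exact mem_coe.2 (mem_image_of_mem v hx.1.1)
  rw [hpairs, card_eq_sum_card_image v s]
  exact sq_sum_le_card_mul_sum_sq

open Finset in
/-- If `(u, v)` is injective on `s`, then restricting `s` to the `v`-values that occur together
with a well-chosen value of `u` keeps a large part of `s`, and the values of `f ∘ v` on this part
are no more numerous than those of `a ∘ u + f ∘ v` on `s`. -/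
theorem Finset.exists_subset_card_image_le_card_image_add {α β γ G : Type*} [DecidableEq β]
    [DecidableEq γ] [AddGroup G] [DecidableEq G] (s : Finset α) (u : α → β) (v : α → γ)
    (huv : ∀ p ∈ s, ∀ q ∈ s, u p = u q → v p = v q → p = q) (a : β → G) (f : γ → G) :
    ∃ t ⊆ s, s.card ^ 2 ≤ t.card * ((s.image u).card * (s.image v).card) ∧
      (t.image fun p => f (v p)).card ≤ (s.image fun p => a (u p) + f (v p)).card := by
  classical
  obtain rfl | hs := s.eq_empty_or_nonempty
  · exact ⟨∅, by simp⟩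
  set E := (s ×ˢ s).filter fun x => v x.1 = v x.2 with hE
  obtain ⟨b, -, hb⟩ : ∃ b ∈ s.image u,
      E.card ≤ (s.image u).card * (E.filter fun x => u x.2 = b).card := by
    by_contra! h
    have hsum : E.card = ∑ b ∈ s.image u, (E.filter fun x => u x.2 = b).card :=
      card_eq_sum_card_fiberwise fun x hx => by
        simp only [hE, coe_filter, mem_product, Set.mem_ofPred_eq] at hx
        exact mem_coe.2 (mem_image_of_mem u hx.1.2)
    have hlt := sum_lt_sum_of_nonempty (hs.image u) h
    rw [← mul_sum, ← hsum, sum_const, smul_eq_mul] at hlt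
    exact lt_irrefl _ hlt
  refine ⟨s.filter fun p => ∃ q ∈ s, u q = b ∧ v q = v p, filter_subset _ _, ?_, ?_⟩
  · have hfib : (E.filter fun x => u x.2 = b).card ≤
        (s.filter fun p => ∃ q ∈ s, u q = b ∧ v q = v p).card := by
      refine card_le_card_of_injOn Prod.fst ?_ ?_
      · intro x hx
        simp only [hE, coe_filter, mem_filter, mem_product, Set.mem_ofPred_eq] at hx ⊢
        exact ⟨hx.1.1.1, x.2, hx.1.1.2, hx.2, hx.1.2.symm⟩
      · intro x hx y hy hxy
        simp only [hE, coe_filter, mem_filter, mem_product, Set.mem_ofPred_eq] at hx hy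
        refine Prod.ext hxy (huv _ hx.1.1.2 _ hy.1.1.2 (hx.2.trans hy.2.symm) ?_)
        rw [← hx.1.2, ← hy.1.2, hxy]
    calc s.card ^ 2 ≤ (s.image v).card * E.card :=
          s.sq_card_le_card_image_mul_card_fibre_pairs v
      _ ≤ (s.image v).card * ((s.image u).card *
            (s.filter fun p => ∃ q ∈ s, u q = b ∧ v q = v p).card) := by
          gcongr
          exact hb.trans (by gcongr)
      _ = _ := by ring
  · refine (card_le_card ?_).trans
      (card_image_le (s := s.image fun p => a (u p) + f (v p)) (f := fun z => -a b + z))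
    intro z hz
    simp only [mem_image, mem_filter] at hz ⊢
    obtain ⟨p, ⟨-, q, hq, rfl, hv⟩, rfl⟩ := hz
    exact ⟨_, ⟨q, hq, rfl⟩, by rw [hv]; simp⟩

/-- Refinement with few sums (Proposition 12.2, d = 5/2 case): given the additive model
Ω₁ ⊆ ℤ⁴ carrying the direct functional relationship x₀ = h̃(y₂) and, with
f(y₂) = y₂ + h̃(y₂), few values of (x₂+y₀)+f(y₂), one can pass to a subset Ω₂ of
comparable size on which the sets A' = {x₂+y₀} and B' = {f(y₂)} both have cardinality
≲ M^{C√ε} M^{1/2}. -/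
theorem refinement_few_sums (C₀ : ℝ) (hC₀ : 0 < C₀) :
    ∃ A C ε₀ : ℝ, 0 < A ∧ 0 < C ∧ 0 < ε₀ ∧
      ∀ ε : ℝ, 0 < ε → ε < ε₀ →
        ∃ M₀ : ℝ, ∀ M : ℝ, M₀ ≤ M →
          ∀ (Ω₁ : Finset (ℤ × ℤ × ℤ × ℤ)) (ht : ℤ → ℤ),
            M ^ (-(C₀ * Real.sqrt ε)) * M ^ 2 ≤ (Ω₁.card : ℝ) →
            ((Ω₁.image fun p => p.1).card : ℝ) ≤ M ^ (C₀ * Real.sqrt ε) * M →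
            ((Ω₁.image fun p => p.2.1).card : ℝ) ≤
              M ^ (C₀ * Real.sqrt ε) * M ^ ((1 : ℝ) / 2) →
            ((Ω₁.image fun p => p.2.2.1).card : ℝ) ≤
              M ^ (C₀ * Real.sqrt ε) * M ^ ((1 : ℝ) / 2) →
            ((Ω₁.image fun p => p.2.2.2).card : ℝ) ≤ M ^ (C₀ * Real.sqrt ε) * M →
            (∀ p ∈ Ω₁, p.1 = ht p.2.2.2) →
            ((Ω₁.image fun p =>
                (p.2.2.1 + p.2.1) + (p.2.2.2 + ht p.2.2.2)).card : ℝ) ≤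
              M ^ (C₀ * Real.sqrt ε) * M ^ ((1 : ℝ) / 2) →
            ∃ Ω₂ : Finset (ℤ × ℤ × ℤ × ℤ), Ω₂ ⊆ Ω₁ ∧
              A⁻¹ * M ^ (-(C * Real.sqrt ε)) * M ^ 2 ≤ (Ω₂.card : ℝ) ∧
              ((Ω₂.image fun p => p.2.2.1 + p.2.1).card : ℝ) ≤
                A * M ^ (C * Real.sqrt ε) * M ^ ((1 : ℝ) / 2) ∧
              ((Ω₂.image fun p => p.2.2.2 + ht p.2.2.2).card : ℝ) ≤
                A * M ^ (C * Real.sqrt ε) * M ^ ((1 : ℝ) / 2) := by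
  refine ⟨1, 13 * C₀, 1, one_pos, by positivity, one_pos, fun ε hε _ => ⟨1, ?_⟩⟩
  intro M hM Ω₁ ht hcard _ hY₀ hX₂ hY₂ hfun hsum
  have hM0 : 0 < M := by linarith
  set K := M ^ (C₀ * Real.sqrt ε) with hK
  have hK1 : 1 ≤ K := Real.one_le_rpow hM (by positivity)
  have hK0 : 0 < K := by linarith
  have hKneg : M ^ (-(C₀ * Real.sqrt ε)) = K⁻¹ := Real.rpow_neg hM0.le _
  have hKC : M ^ (13 * C₀ * Real.sqrt ε) = K ^ 13 := by
    rw [hK, ← Real.rpow_natCast, ← Real.rpow_mul hM0.le]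
    congr 1
    push_cast
    ring
  have hKCneg : M ^ (-(13 * C₀ * Real.sqrt ε)) = (K ^ 13)⁻¹ := by
    rw [Real.rpow_neg hM0.le, hKC]
  have hsq : M ^ ((1 : ℝ) / 2) * M ^ ((1 : ℝ) / 2) = M := by
    rw [← Real.rpow_add hM0]
    norm_num
  rw [hKneg] at hcard
  rw [hKC, hKCneg, inv_one, one_mul, one_mul]
  set N := M ^ ((1 : ℝ) / 2) with hN
  have hN0 : 0 < N := Real.rpow_pos_of_pos hM0 _
  let u : ℤ × ℤ × ℤ × ℤ → ℤ × ℤ := fun p => (p.2.2.1, p.2.1)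
  let v : ℤ × ℤ × ℤ × ℤ → ℤ := fun p => p.2.2.2
  let a : ℤ × ℤ → ℤ := fun w => w.1 + w.2
  let f : ℤ → ℤ := fun y => y + ht y
  have huv : ∀ p ∈ Ω₁, ∀ q ∈ Ω₁, u p = u q → v p = v q → p = q := by
    rintro ⟨x₀, y₀, x₂, y₂⟩ hp ⟨x₀', y₀', x₂', y₂'⟩ hq hu hv
    have h₁ := hfun _ hp
    have h₂ := hfun _ hq
    simp only [u, v, Prod.mk.injEq] at *
    grind
  obtain ⟨Ω', hΩ', hcard', hf⟩ := Ω₁.exists_subset_card_image_le_card_image_add u v huv a f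
  obtain ⟨Ω₂, hΩ₂, hcard₂, ha⟩ := Ω'.exists_subset_card_image_le_card_image_add v u
    (fun p hp q hq hv hu => huv p (hΩ' hp) q (hΩ' hq) hu hv) f a
  have hS : ((Ω₁.image fun p => a (u p) + f (v p)).card : ℝ) ≤ K ^ 13 * N :=
    hsum.trans (by gcongr; exact le_self_pow₀ hK1 (by norm_num))
  have hU : ((Ω₁.image u).card : ℝ) ≤ (K * N) * (K * N) := by
    have hsub : Ω₁.image u ⊆ (Ω₁.image fun p => p.2.2.1) ×ˢ (Ω₁.image fun p => p.2.1) := by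
      intro w hw
      obtain ⟨p, hp, rfl⟩ := Finset.mem_image.1 hw
      exact Finset.mem_product.2
        ⟨Finset.mem_image_of_mem (fun p => p.2.2.1) hp,
          Finset.mem_image_of_mem (fun p => p.2.1) hp⟩
    have h := Finset.card_le_card hsub
    rw [Finset.card_product] at h
    calc ((Ω₁.image u).card : ℝ) ≤
          (Ω₁.image fun p => p.2.2.1).card * (Ω₁.image fun p => p.2.1).card := by
            exact_mod_cast h
      _ ≤ _ := by gcongr
  have hUV : ((Ω₁.image u).card : ℝ) * (Ω₁.image v).card ≤ K ^ 3 * M ^ 2 :=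
    calc _ ≤ ((K * N) * (K * N)) * (K * M) := by gcongr
      _ = K ^ 3 * (N * N) * M := by ring
      _ = _ := by rw [hsq]; ring
  have refine_card : ∀ (x y : ℕ) (k : ℕ), (K ^ k)⁻¹ * M ^ 2 ≤ x →
      x ^ 2 ≤ y * ((Ω₁.image u).card * (Ω₁.image v).card) →
      (K ^ (2 * k + 3))⁻¹ * M ^ 2 ≤ (y : ℝ) := by
    intro x y k hx hxy
    have h₁ : (x : ℝ) ^ 2 ≤ y * (K ^ 3 * M ^ 2) :=
      calc (x : ℝ) ^ 2 ≤ y * ((Ω₁.image u).card * (Ω₁.image v).card) := by exact_mod_cast hxy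
        _ ≤ _ := by gcongr
    have h₂ : ((K ^ k)⁻¹ * M ^ 2) ^ 2 ≤ (x : ℝ) ^ 2 := by gcongr
    refine le_of_mul_le_mul_right ?_ (show 0 < K ^ 3 * M ^ 2 by positivity)
    refine le_trans (le_of_eq ?_) (h₂.trans h₁)
    rw [pow_add, pow_mul']
    field_simp
  have hΩ'card : (K ^ 5)⁻¹ * M ^ 2 ≤ (Ω'.card : ℝ) :=
    refine_card _ _ 1 (by simpa using hcard) hcard'
  refine ⟨Ω₂, hΩ₂.trans hΩ', refine_card _ _ 5 hΩ'card ?_, ?_, ?_⟩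
  · refine hcard₂.trans ?_
    rw [mul_comm (Ω'.image v).card]
    gcongr
  · refine le_trans ?_ hS
    have h : (Ω'.image fun p => f (v p) + a (u p)).card ≤
        (Ω₁.image fun p => a (u p) + f (v p)).card := by
      simp_rw [add_comm (f _)]
      gcongr
    exact_mod_cast ha.trans h
  · refine le_trans ?_ hS
    have h : (Ω₂.image fun p => f (v p)).card ≤ (Ω'.image fun p => f (v p)).card := by gcongr
    exact_mod_cast h.trans hf
end

section
/- (Bourgain's sum–difference lemma.) There exist absolute constants ε > 0 and C such that for every N ≥ 2 and all finite sets A, B ⊆ ℤ with #A ≤ N and #B ≤ N, and every G ⊆ A × B with #{a + b : (a, b) ∈ G} ≤ N, one has #{a − b : (a, b) ∈ G} ≤ C N^{2−ε}. -/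
open Finset in
/-- Summing the reciprocal of the size of the fiber through each point counts the fibers. -/
theorem sum_inv_card_fiber {α β : Type*} [DecidableEq β] (s : Finset α) (f : α → β) :
    ∑ y ∈ s, (((s.filter fun x => f x = f y).card : ℝ))⁻¹ = (s.image f).card := by
  rw [← sum_fiberwise_of_maps_to (g := f) (t := s.image f) fun x hx => mem_image_of_mem f hx]
  rw [card_eq_sum_ones, Nat.cast_sum]
  refine sum_congr rfl fun b hb => ?_
  obtain ⟨x, hx, rfl⟩ := mem_image.1 hb
  have hpos : ((s.filter fun z => f z = f x).card : ℝ) ≠ 0 :=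
    Nat.cast_ne_zero.2 (card_pos.2 ⟨x, by simp [hx]⟩).ne'
  have hconst : ∀ y ∈ s.filter (fun z => f z = f x),
      (((s.filter fun z => f z = f y).card : ℝ))⁻¹ =
        (((s.filter fun z => f z = f x).card : ℝ))⁻¹ := by
    intro y hy
    rw [(mem_filter.1 hy).2]
  rw [sum_congr rfl hconst, sum_const, nsmul_eq_mul, mul_inv_cancel₀ hpos]
  simp

open Finset in
/-- Lower bound for the number of pairs of points lying in a common fiber. -/
theorem card_sq_le_mul_sum_card_fiber {α β : Type*} [DecidableEq β] (s : Finset α) (f : α → β)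
    {K : ℝ} (hf : ((s.image f).card : ℝ) ≤ K) :
    (s.card : ℝ) ^ 2 ≤ K * ∑ y ∈ s, ((s.filter fun x => f x = f y).card : ℝ) := by
  have hK := sum_inv_card_fiber s f ▸ hf
  have hcs := sum_sq_le_sum_mul_sum_of_sq_le_mul s (r := fun _ => (1 : ℝ))
    (f := fun y => (((s.filter fun x => f x = f y).card : ℝ))⁻¹)
    (g := fun y => ((s.filter fun x => f x = f y).card : ℝ))
    (fun _ _ => by positivity) (fun _ _ => by positivity) (fun y hy => by
      have : ((s.filter fun z => f z = f y).card : ℝ) ≠ 0 :=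
        Nat.cast_ne_zero.2 (card_pos.2 ⟨y, by simp [hy]⟩).ne'
      rw [inv_mul_cancel₀ this, one_pow])
  simp only [sum_const, nsmul_eq_mul, mul_one] at hcs
  exact hcs.trans (mul_le_mul_of_nonneg_right hK (by positivity))

/-- The inequality `3 ≤ x y + x⁻¹ + y⁻¹`, homogenized. -/
theorem three_le_mul_div_sq_add {x y t : ℝ} (hx : 0 < x) (hy : 0 < y) (ht : 0 < t) :
    3 ≤ x * y / t ^ 2 + t * x⁻¹ + t * y⁻¹ := by
  have key : ∀ u v : ℝ, 0 < u → 0 < v → 3 ≤ u⁻¹ * v⁻¹ + u + v := by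
    intro u v hu hv
    have h : 3 * (u * v) ≤ 1 + u * (u * v) + v * (u * v) := by
      nlinarith [mul_nonneg (add_pos hu hv).le (sq_nonneg (u - v)),
        mul_nonneg (add_pos hu hv).le (sq_nonneg (u + v - 2)), sq_nonneg (u - v),
        sq_nonneg (u + v - 2), mul_pos hu hv]
    have : u⁻¹ * v⁻¹ + u + v = (1 + u * (u * v) + v * (u * v)) / (u * v) := by field_simp
    rw [this, le_div_iff₀ (by positivity)]
    exact h
  have := key (t * x⁻¹) (t * y⁻¹) (by positivity) (by positivity)
  convert this using 3
  field_simp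

open Finset in
/-- Lower bound for the number of triples `(x, y, z)` with `f x = f y` and `g y = g z`. -/
theorem card_pow_three_le_mul_sum_card_fiber {α β γ : Type*} [DecidableEq β] [DecidableEq γ]
    (s : Finset α) (f : α → β) (g : α → γ) {K : ℝ} (hK : 0 < K)
    (hf : ((s.image f).card : ℝ) ≤ K) (hg : ((s.image g).card : ℝ) ≤ K) :
    (s.card : ℝ) ^ 3 ≤ K ^ 2 * ∑ y ∈ s, ((s.filter fun x => f x = f y).card : ℝ) *
      ((s.filter fun z => g z = g y).card : ℝ) := by
  rcases s.eq_empty_or_nonempty with rfl | hs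
  · simp
  have hcard : (0 : ℝ) < s.card := by exact_mod_cast hs.card_pos
  rw [← sum_inv_card_fiber] at hf hg
  set t : ℝ := s.card / K with ht
  have htpos : 0 < t := by positivity
  have hsum := sum_le_sum fun y (hy : y ∈ s) => three_le_mul_div_sq_add
    (x := ((s.filter fun x => f x = f y).card : ℝ)) (y := ((s.filter fun z => g z = g y).card : ℝ))
    (Nat.cast_pos.2 (card_pos.2 ⟨y, by simp [hy]⟩))
    (Nat.cast_pos.2 (card_pos.2 ⟨y, by simp [hy]⟩)) htpos
  rw [sum_add_distrib, sum_add_distrib, ← sum_div, ← mul_sum, ← mul_sum, sum_const,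
    nsmul_eq_mul] at hsum
  have h₁ := mul_le_mul_of_nonneg_left hf htpos.le
  have h₂ := mul_le_mul_of_nonneg_left hg htpos.le
  have htK : t * K = s.card := by rw [ht]; field_simp
  set T := ∑ y ∈ s, ((s.filter fun x => f x = f y).card : ℝ) *
      ((s.filter fun z => g z = g y).card : ℝ)
  have h₃ : (s.card : ℝ) ≤ T / t ^ 2 := by linarith
  rw [le_div_iff₀ (by positivity)] at h₃
  calc (s.card : ℝ) ^ 3 = K ^ 2 * (s.card * t ^ 2) := by rw [ht]; field_simp
    _ ≤ K ^ 2 * T := by gcongr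

open Finset in
/-- The Katz–Tao estimate: if `(a, b) ↦ a - b` is injective on `G ⊆ A × B`, and `A`, `B` and the
restricted sumset of `G` have at most `N` elements, then `#G ^ 6 ≤ N ^ 11`. -/
theorem card_pow_six_le_of_injOn_sub {N : ℝ} (hN : 0 < N) {A B : Finset ℤ} (hA : (A.card : ℝ) ≤ N)
    (hB : (B.card : ℝ) ≤ N) {G : Finset (ℤ × ℤ)} (hG : G ⊆ A ×ˢ B)
    (hS : ((G.image fun p => p.1 + p.2).card : ℝ) ≤ N)
    (hinj : Set.InjOn (fun p : ℤ × ℤ => p.1 - p.2) G) :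
    (G.card : ℝ) ^ 6 ≤ N ^ 11 := by
  set S := G.image fun p => p.1 + p.2 with hSdef
  set V : Finset ((ℤ × ℤ) × (ℤ × ℤ)) := (G ×ˢ G).filter fun v => v.1.1 = v.2.1 with hV
  have hVmem : ∀ v ∈ V, v.1 ∈ G ∧ v.2 ∈ G ∧ v.1.1 = v.2.1 := by
    intro v hv
    simpa [hV, and_assoc] using hv
  have hGA : ∀ p ∈ G, p.1 ∈ A := fun p hp => (mem_product.1 (hG hp)).1
  have hGB : ∀ p ∈ G, p.2 ∈ B := fun p hp => (mem_product.1 (hG hp)).2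
  have hGS : ∀ p ∈ G, p.1 + p.2 ∈ S := fun p hp => mem_image_of_mem (fun p => p.1 + p.2) hp
  have hVcard : (G.card : ℝ) ^ 2 ≤ N * V.card := by
    have hle : ((G.image Prod.fst).card : ℝ) ≤ N :=
      le_trans (by exact_mod_cast card_le_card (image_subset_iff.2 hGA)) hA
    convert card_sq_le_mul_sum_card_fiber G Prod.fst hle
    rw [hV, card_filter, sum_product_right]
    push_cast [card_filter]
    rfl
  let f : (ℤ × ℤ) × (ℤ × ℤ) → ℤ × ℤ := fun v => (v.1.2, v.2.2)
  let g : (ℤ × ℤ) × (ℤ × ℤ) → ℤ × ℤ := fun v => (v.1.2, v.2.1 + v.2.2)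
  have hf : ((V.image f).card : ℝ) ≤ N ^ 2 := by
    have hsub : V.image f ⊆ B ×ˢ B := image_subset_iff.2 fun v hv =>
      mem_product.2 ⟨hGB v.1 (hVmem v hv).1, hGB v.2 (hVmem v hv).2.1⟩
    calc ((V.image f).card : ℝ) ≤ B.card * B.card := by
          exact_mod_cast (card_le_card hsub).trans_eq (card_product _ _)
      _ ≤ N * N := by gcongr
      _ = N ^ 2 := by ring
  have hg : ((V.image g).card : ℝ) ≤ N ^ 2 := by
    have hsub : V.image g ⊆ B ×ˢ S := image_subset_iff.2 fun v hv =>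
      mem_product.2 ⟨hGB v.1 (hVmem v hv).1, hGS v.2 (hVmem v hv).2.1⟩
    calc ((V.image g).card : ℝ) ≤ B.card * S.card := by
          exact_mod_cast (card_le_card hsub).trans_eq (card_product _ _)
      _ ≤ N * N := by gcongr
      _ = N ^ 2 := by ring
  have hchain := card_pow_three_le_mul_sum_card_fiber V f g (by positivity) hf hg
  have hW : (∑ y ∈ V, ((V.filter fun x => f x = f y).card : ℝ) *
      ((V.filter fun z => g z = g y).card : ℝ)) ≤ N ^ 4 := by
    let W := V.sigma fun y => (V.filter fun x => f x = f y) ×ˢ (V.filter fun z => g z = g y)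
    have hWcard : W.card ≤ (S ×ˢ S ×ˢ A ×ˢ B).card := by
      refine card_le_card_of_injOn (fun w =>
        (w.2.1.1.1 + w.2.1.1.2, w.2.1.2.1 + w.2.1.2.2, w.1.1.1, w.2.2.2.2)) ?_ ?_
      · rintro ⟨y, x, z⟩ hw
        simp only [W, coe_sigma, Set.mem_sigma_iff, mem_coe, mem_product, mem_filter] at hw
        obtain ⟨hy, ⟨hx, -⟩, hz, -⟩ := hw
        simp only [coe_product, Set.mem_prod, mem_coe]
        exact ⟨hGS _ (hVmem x hx).1, hGS _ (hVmem x hx).2.1, hGA _ (hVmem y hy).1,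
          hGB _ (hVmem z hz).2.1⟩
      · rintro ⟨⟨⟨a₁, b₁⟩, ⟨a₁', b₁'⟩⟩, ⟨⟨a₀, b₀⟩, ⟨a₀', b₀'⟩⟩, ⟨⟨a₂, b₂⟩, ⟨a₂', b₂'⟩⟩⟩ hw
          ⟨⟨⟨c₁, d₁⟩, ⟨c₁', d₁'⟩⟩, ⟨⟨c₀, d₀⟩, ⟨c₀', d₀'⟩⟩, ⟨⟨c₂, d₂⟩, ⟨c₂', d₂'⟩⟩⟩ hw' heq
        simp only [W, f, g, coe_sigma, Set.mem_sigma_iff, mem_coe, mem_product, mem_filter,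
          Prod.mk.injEq] at hw hw' heq
        obtain ⟨hy, ⟨hx, hxy⟩, hz, hzy⟩ := hw
        obtain ⟨hy', ⟨hx', hxy'⟩, hz', hzy'⟩ := hw'
        obtain ⟨-, -, hya⟩ := hVmem _ hy
        obtain ⟨-, -, hya'⟩ := hVmem _ hy'
        obtain ⟨-, -, hxa⟩ := hVmem _ hx
        obtain ⟨-, -, hxa'⟩ := hVmem _ hx'
        obtain ⟨hzG, -, hza⟩ := hVmem _ hz
        obtain ⟨hzG', -, hza'⟩ := hVmem _ hz'
        dsimp only at hya hya' hxa hxa' hza hza' hzG hzG'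
        have hdiff : ((a₂, b₂) : ℤ × ℤ) = (c₂, d₂) := hinj hzG hzG' (by dsimp only; lia)
        rw [Prod.mk.injEq] at hdiff
        simp only [Sigma.mk.injEq, heq_eq_eq, Prod.mk.injEq]
        lia
    calc _ = (W.card : ℝ) := by simp [W, card_sigma, card_product]
      _ ≤ S.card * (S.card * (A.card * B.card)) := by
          rw [card_product, card_product, card_product] at hWcard
          exact_mod_cast hWcard
      _ ≤ N * (N * (N * N)) := by gcongr
      _ = N ^ 4 := by ring
  calc (G.card : ℝ) ^ 6 = ((G.card : ℝ) ^ 2) ^ 3 := by ring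
    _ ≤ (N * V.card) ^ 3 := by gcongr
    _ = N ^ 3 * (V.card : ℝ) ^ 3 := by ring
    _ ≤ N ^ 3 * ((N ^ 2) ^ 2 * N ^ 4) := by
        gcongr
        exact hchain.trans (by gcongr)
    _ = N ^ 11 := by ring


/-- Bourgain's sum–difference lemma (Lemma 14.1): there are absolute constants ε > 0
and C such that whenever A, B ⊆ ℤ have cardinality at most N and G ⊆ A × B has
restricted sumset of cardinality at most N, the restricted difference set of G has
cardinality at most C N^{2-ε}. -/
theorem bourgain_sum_difference :
    ∃ ε C : ℝ, 0 < ε ∧ 0 < C ∧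
      ∀ N : ℝ, 2 ≤ N →
        ∀ A B : Finset ℤ, (A.card : ℝ) ≤ N → (B.card : ℝ) ≤ N →
          ∀ G : Finset (ℤ × ℤ), G ⊆ A ×ˢ B →
            ((G.image fun p => p.1 + p.2).card : ℝ) ≤ N →
            ((G.image fun p => p.1 - p.2).card : ℝ) ≤ C * N ^ (2 - ε) := by
  refine ⟨1 / 6, 1, by norm_num, one_pos, fun N hN A B hA hB G hG hS => ?_⟩
  have hN0 : 0 < N := by linarith
  obtain ⟨H, hHG, hinj, himage⟩ :=
    (Set.surjOn_image (fun p : ℤ × ℤ => p.1 - p.2) (G : Set (ℤ × ℤ))).exists_subset_injOn_image_eq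
  lift H to Finset (ℤ × ℤ) using G.finite_toSet.subset hHG
  have hHG' : H ⊆ G := Finset.coe_subset.1 hHG
  have hcard : (G.image fun p => p.1 - p.2).card = H.card := by
    rw [← Finset.card_image_of_injOn hinj]
    congr 1
    exact_mod_cast himage.symm
  have hpow := card_pow_six_le_of_injOn_sub hN0 hA hB (hHG'.trans hG)
    (le_trans (by exact_mod_cast Finset.card_le_card (Finset.image_subset_image hHG')) hS) hinj
  rw [hcard, one_mul]
  refine le_of_pow_le_pow_left₀ (n := 6) (by norm_num) (by positivity) (hpow.trans_eq ?_)
  rw [← Real.rpow_natCast (N ^ _), ← Real.rpow_mul hN0.le, ← Real.rpow_natCast]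
  norm_num
end

section
/- (Popular differences.) Let N ≥ 1 and K ≥ 1, and let A, B ⊆ ℤ be finite sets with #A ≤ N and #B ≤ N. Suppose G ⊆ A × B satisfies #{a + b : (a,b) ∈ G} ≤ N and #G ≥ N²/K. Then there exist at least N/(2K²) integers d such that #{(a, b) ∈ A × B : a − b = d} ≥ N/(2K²). -/
/-- The number of pairs on which `f` collides is the sum of the squared fibre sizes. -/
theorem sum_sq_card_fiber_eq_card_collisions {α β : Type*} [DecidableEq β]
    (s : Finset α) (f : α → β) :
    ∑ y ∈ s.image f, (s.filter fun p => f p = y).card ^ 2 =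
      ((s ×ˢ s).filter fun x => f x.1 = f x.2).card := by
  classical
  rw [Finset.card_eq_sum_card_fiberwise (f := fun x => f x.1) (t := s.image f)]
  · refine Finset.sum_congr rfl fun y _ => ?_
    rw [sq, ← Finset.card_product]
    congr 1
    ext x
    simp only [Finset.mem_product, Finset.mem_filter]
    grind
  · intro x hx
    simp only [Finset.coe_filter, Finset.mem_product, Set.mem_ofPred_eq] at hx
    exact Finset.mem_coe.2 (Finset.mem_image_of_mem f hx.1.1)

/-- Additive quadruples in a subset of `A ×ˢ B` rearrange to quadruples with equal differences. -/
theorem card_sum_collisions_le_card_sub_collisions (A B : Finset ℤ)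
    (G : Finset (ℤ × ℤ)) (hG : G ⊆ A ×ˢ B) :
    ((G ×ˢ G).filter fun x => x.1.1 + x.1.2 = x.2.1 + x.2.2).card ≤
      (((A ×ˢ B) ×ˢ (A ×ˢ B)).filter fun x => x.1.1 - x.1.2 = x.2.1 - x.2.2).card := by
  refine Finset.card_le_card_of_injOn
    (fun x => ((x.1.1, x.2.2), (x.2.1, x.1.2))) ?_ ?_
  · rintro ⟨⟨a, b⟩, ⟨c, d⟩⟩ hx
    simp only [Finset.coe_filter, Finset.mem_product, Set.mem_ofPred_eq] at hx ⊢
    obtain ⟨⟨h₁, h₂⟩, h⟩ := hx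
    have k₁ := Finset.mem_product.1 (hG h₁)
    have k₂ := Finset.mem_product.1 (hG h₂)
    exact ⟨⟨⟨k₁.1, k₂.2⟩, ⟨k₂.1, k₁.2⟩⟩, by linarith⟩
  · rintro ⟨⟨a, b⟩, ⟨c, d⟩⟩ _ ⟨⟨a', b'⟩, ⟨c', d'⟩⟩ _ h
    simp only [Prod.mk.injEq] at h ⊢
    tauto

/-- A difference has at most `A.card` representations in `A ×ˢ B`. -/
theorem card_sub_fiber_le (A B : Finset ℤ) (d : ℤ) :
    ((A ×ˢ B).filter fun p => p.1 - p.2 = d).card ≤ A.card := by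
  refine Finset.card_le_card_of_injOn Prod.fst ?_ ?_
  · intro p hp
    simp only [Finset.coe_filter, Finset.mem_product, Set.mem_ofPred_eq] at hp
    exact hp.1.1
  · rintro ⟨a, b⟩ hp ⟨a', b'⟩ hq h
    simp only [Finset.coe_filter, Set.mem_ofPred_eq] at hp hq h
    have h₁ := hp.2
    have h₂ := hq.2
    ext <;> simp only <;> linarith

/-- Popular differences (Proposition 14.2): if A, B ⊆ ℤ have cardinality at most N,
G ⊆ A × B has restricted sumset of cardinality at most N, and #G ≥ N²/K, then there
are at least N/(2K²) integers d such that a − b = d has at least N/(2K²) solutions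
with (a, b) ∈ A × B. -/
theorem popular_differences (N K : ℝ) (hN : 1 ≤ N) (hK : 1 ≤ K)
    (A B : Finset ℤ) (hA : (A.card : ℝ) ≤ N) (hB : (B.card : ℝ) ≤ N)
    (G : Finset (ℤ × ℤ)) (hG : G ⊆ A ×ˢ B)
    (hsum : ((G.image fun p => p.1 + p.2).card : ℝ) ≤ N)
    (hcard : N ^ 2 / K ≤ (G.card : ℝ)) :
    ∃ D : Finset ℤ, N / (2 * K ^ 2) ≤ (D.card : ℝ) ∧
      ∀ d ∈ D,
        N / (2 * K ^ 2) ≤ (((A ×ˢ B).filter fun p => p.1 - p.2 = d).card : ℝ) := by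
  have hN0 : 0 < N := by linarith
  have hK0 : 0 < K := by linarith
  set t := N / (2 * K ^ 2) with ht
  have ht0 : 0 < t := by positivity
  set T := (A ×ˢ B).image fun p => p.1 - p.2
  set r : ℤ → ℝ := fun d => (((A ×ˢ B).filter fun p => p.1 - p.2 = d).card : ℝ) with hr
  have hr0 : ∀ d, 0 ≤ r d := fun d => Nat.cast_nonneg _
  have hrN : ∀ d, r d ≤ N := fun d =>
    (Nat.cast_le.2 (card_sub_fiber_le A B d)).trans hA
  have hrsum : ∑ d ∈ T, r d ≤ N ^ 2 := by
    have h := Finset.card_eq_sum_card_image (fun p : ℤ × ℤ => p.1 - p.2) (A ×ˢ B)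
    have h' : ∑ d ∈ T, r d = (A.card : ℝ) * B.card := by
      rw [Finset.card_product] at h
      simp only [hr, T]
      exact_mod_cast h.symm
    rw [h', sq]
    exact mul_le_mul hA hB (Nat.cast_nonneg _) hN0.le
  have hquad : ∑ y ∈ G.image (fun p => p.1 + p.2),
      ((G.filter fun p => p.1 + p.2 = y).card : ℝ) ^ 2 ≤ ∑ d ∈ T, r d ^ 2 := by
    have h := card_sum_collisions_le_card_sub_collisions A B G hG
    rw [← sum_sq_card_fiber_eq_card_collisions G fun p : ℤ × ℤ => p.1 + p.2,
      ← sum_sq_card_fiber_eq_card_collisions (A ×ˢ B) fun p : ℤ × ℤ => p.1 - p.2] at h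
    simp only [hr, T]
    exact_mod_cast h
  have hcs : (G.card : ℝ) ^ 2 ≤ N * ∑ d ∈ T, r d ^ 2 := by
    have h := Finset.card_eq_sum_card_image (fun p : ℤ × ℤ => p.1 + p.2) G
    have h' : (G.card : ℝ) = ∑ y ∈ G.image (fun p => p.1 + p.2),
        ((G.filter fun p => p.1 + p.2 = y).card : ℝ) := by exact_mod_cast h
    rw [h']
    refine sq_sum_le_card_mul_sum_sq.trans ?_
    exact mul_le_mul hsum hquad (Finset.sum_nonneg fun _ _ => sq_nonneg _) hN0.le
  have henergy : 2 * t * N ^ 2 ≤ ∑ d ∈ T, r d ^ 2 := by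
    have h : (N ^ 2 / K) ^ 2 ≤ (G.card : ℝ) ^ 2 := by gcongr
    have h' : (N ^ 2 / K) ^ 2 = N * (2 * t * N ^ 2) := by
      rw [ht]
      field_simp
    rw [h'] at h
    exact le_of_mul_le_mul_left (h.trans hcs) hN0
  have hsplit := Finset.sum_filter_add_sum_filter_not T (fun d => t ≤ r d) fun d => r d ^ 2
  have hpop : ∑ d ∈ T with t ≤ r d, r d ^ 2 ≤ (T.filter fun d => t ≤ r d).card * N ^ 2 := by
    rw [← nsmul_eq_mul]
    exact Finset.sum_le_card_nsmul _ _ _ fun d _ => pow_le_pow_left₀ (hr0 d) (hrN d) 2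
  have hunpop : ∑ d ∈ T with ¬ t ≤ r d, r d ^ 2 ≤ t * N ^ 2 := by
    calc ∑ d ∈ T with ¬ t ≤ r d, r d ^ 2
        ≤ ∑ d ∈ T with ¬ t ≤ r d, t * r d := by
          refine Finset.sum_le_sum fun d hd => ?_
          rw [sq]
          exact mul_le_mul_of_nonneg_right (not_le.1 (Finset.mem_filter.1 hd).2).le (hr0 d)
      _ ≤ ∑ d ∈ T, t * r d :=
          Finset.sum_le_sum_of_subset_of_nonneg (Finset.filter_subset _ _)
            fun d _ _ => mul_nonneg ht0.le (hr0 d)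
      _ ≤ t * N ^ 2 := by
          rw [← Finset.mul_sum]
          exact mul_le_mul_of_nonneg_left hrsum ht0.le
  refine ⟨T.filter fun d => t ≤ r d, ?_, fun d hd => (Finset.mem_filter.1 hd).2⟩
  have hN2 : 0 < N ^ 2 := by positivity
  refine le_of_mul_le_mul_right ?_ hN2
  linarith
end

section
/- (Key refinement with small difference set.) Let c₀ > 0. There exist constants C > 0 (depending only on c₀) such that the following holds for all sufficiently small ε > 0 and all sufficiently large N. Let A, B ⊆ ℤ be finite with #A ≤ N and #B ≤ N, and let G ⊆ A × B satisfy #{a + b : (a,b) ∈ G} ≤ N and #G ≥ N^{2 − c₀√ε}. Then there exist subsets A' ⊆ A and B' ⊆ B such that #(G ∩ (A' × B')) ≥ N^{2 − C√ε} and #{a' − b' : (a', b') ∈ A' × B'} ≤ N^{1 + C√ε}. -/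
open Finset in
/-- Discarding the indices where `f` is below `c` lowers the sum by at most `#s * c`. -/
lemma Finset.sum_le_sum_filter_le_add_card_mul {ι : Type*} (s : Finset ι) (f : ι → ℝ) {c : ℝ}
    (hc : 0 ≤ c) : ∑ i ∈ s, f i ≤ ∑ i ∈ s with c ≤ f i, f i + #s * c := by
  rw [← sum_filter_add_sum_filter_not s (fun i ↦ c ≤ f i) f]
  gcongr
  calc ∑ i ∈ s with ¬c ≤ f i, f i ≤ #{i ∈ s | ¬c ≤ f i} • c :=
        sum_le_card_nsmul _ _ _ fun i hi ↦ (not_le.1 (mem_filter.1 hi).2).le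
    _ ≤ #s * c := by
        rw [nsmul_eq_mul]
        gcongr
        exact filter_subset _ _

open Finset in
/-- Real-valued double counting of the pairs of a relation. -/
lemma Finset.sum_card_filter_comm {α β : Type*} (s : Finset α) (t : Finset β) (r : α → β → Prop)
    [∀ a b, Decidable (r a b)] :
    ∑ a ∈ s, (#{b ∈ t | r a b} : ℝ) = ∑ b ∈ t, (#{a ∈ s | r a b} : ℝ) := by
  exact_mod_cast sum_card_bipartiteAbove_eq_sum_card_bipartiteBelow (s := s) (t := t) r

open Finset in
lemma Finset.card_filter_product_eq_sum {α β : Type*} (s : Finset α) (t : Finset β)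
    (r : α → β → Prop) [∀ a b, Decidable (r a b)] :
    (#{p ∈ s ×ˢ t | r p.1 p.2} : ℝ) = ∑ a ∈ s, (#{b ∈ t | r a b} : ℝ) := by
  simp only [card_filter, sum_product, Nat.cast_sum]

open Finset Classical in
/-- In a dense bipartite graph some neighbourhood is large and contains few pairs with few
common neighbours; moreover all its vertices have large degree. -/
lemma exists_neighborhood_few_bad_pairs {α β : Type*} (A : Finset α) (B : Finset β)
    (r : α → β → Prop) {n K : ℝ} (hn : 0 < n) (hK : 1 ≤ K) (hA : #A ≤ n) (hB : #B ≤ n)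
    (hr : n ^ 2 / K ≤ ∑ a ∈ A, (#{b ∈ B | r a b} : ℝ)) :
    ∃ X ⊆ A, (∀ a ∈ X, n / (2 * K) ≤ #{b ∈ B | r a b}) ∧ n / (3 * K) ≤ #X ∧
      (∑ a ∈ X, (#{a' ∈ X | (#{b ∈ B | r a b ∧ r a' b} : ℝ) < n / (256 * K ^ 3)} : ℝ))
        ≤ (#X : ℝ) ^ 2 / (32 * K) := by
  have hK0 : 0 < K := by linarith
  have e₁ : n ^ 2 / K = n ^ 2 / (2 * K) + n * (n / (2 * K)) := by field_simp; ring
  have e₂ : (n ^ 2 / (2 * K)) ^ 2 = n * (n ^ 3 / (4 * K ^ 2)) := by field_simp; ring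
  have e₃ : n ^ 3 / (4 * K ^ 2) - 32 * K * (n ^ 2 * (n / (256 * K ^ 3)))
      - n * (n ^ 2 / (9 * K ^ 2)) = n ^ 3 / K ^ 2 / 72 := by field_simp; ring
  have e₄ : (n / (3 * K)) ^ 2 = n ^ 2 / (9 * K ^ 2) := by field_simp; ring
  set A₁ := {a ∈ A | n / (2 * K) ≤ #{b ∈ B | r a b}} with hA₁
  set δ := n / (256 * K ^ 3) with hδ
  have hδ0 : 0 ≤ δ := by positivity
  let X : β → Finset α := fun b ↦ {a ∈ A₁ | r a b}
  let few : α → α → Prop := fun a a' ↦ (#{b ∈ B | r a b ∧ r a' b} : ℝ) < δ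
  let bad : β → ℝ := fun b ↦ ∑ a ∈ X b, (#{a' ∈ X b | few a a'} : ℝ)
  have hA₁n : (#A₁ : ℝ) ≤ n := le_trans (by exact_mod_cast card_filter_le _ _) hA
  have hsum : n ^ 2 / (2 * K) ≤ ∑ b ∈ B, (#(X b) : ℝ) := by
    have h := A.sum_le_sum_filter_le_add_card_mul (fun a ↦ (#{b ∈ B | r a b} : ℝ))
      (c := n / (2 * K)) (by positivity)
    rw [← hA₁, sum_card_filter_comm A₁ B r] at h
    have h2 : (#A : ℝ) * (n / (2 * K)) ≤ n * (n / (2 * K)) := by gcongr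
    linarith
  have hsq : n ^ 3 / (4 * K ^ 2) ≤ ∑ b ∈ B, (#(X b) : ℝ) ^ 2 := by
    have h := sq_sum_le_card_mul_sum_sq (s := B) (f := fun b ↦ (#(X b) : ℝ))
    have h1 : (n ^ 2 / (2 * K)) ^ 2 ≤ (∑ b ∈ B, (#(X b) : ℝ)) ^ 2 := by gcongr
    have h2 : (#B : ℝ) * ∑ b ∈ B, (#(X b) : ℝ) ^ 2 ≤ n * ∑ b ∈ B, (#(X b) : ℝ) ^ 2 :=
      mul_le_mul_of_nonneg_right hB (sum_nonneg fun _ _ ↦ sq_nonneg _)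
    exact le_of_mul_le_mul_left (by linarith) hn
  have hbad : ∑ b ∈ B, bad b ≤ n ^ 2 * δ := by
    have h1 (b : β) : bad b
        = (#{p ∈ {p ∈ A₁ ×ˢ A₁ | few p.1 p.2} | r p.1 b ∧ r p.2 b} : ℝ) := by
      refine (card_filter_product_eq_sum (X b) (X b) few).symm.trans ?_
      congr 2
      ext p
      simp only [X, mem_filter, mem_product]
      tauto
    simp_rw [h1]
    rw [← sum_card_filter_comm _ _ (fun (p : α × α) b ↦ r p.1 b ∧ r p.2 b)]
    calc _ ≤ #{p ∈ A₁ ×ˢ A₁ | few p.1 p.2} • δ :=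
          sum_le_card_nsmul _ _ _ fun p hp ↦ (mem_filter.1 hp).2.le
      _ ≤ (#(A₁ ×ˢ A₁) : ℝ) * δ := by
          rw [nsmul_eq_mul]
          gcongr
          exact filter_subset _ _
      _ ≤ n ^ 2 * δ := by
          rw [card_product, Nat.cast_mul, sq]
          gcongr
  obtain ⟨b, -, hb⟩ : ∃ b ∈ B, n ^ 2 / (9 * K ^ 2) ≤ (#(X b) : ℝ) ^ 2 - 32 * K * bad b := by
    by_contra! h
    have h1 := sum_le_card_nsmul B _ _ fun b hb ↦ (h b hb).le
    rw [sum_sub_distrib, ← mul_sum, nsmul_eq_mul] at h1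
    have h2 : (#B : ℝ) * (n ^ 2 / (9 * K ^ 2)) ≤ n * (n ^ 2 / (9 * K ^ 2)) := by gcongr
    have h3 : 32 * K * ∑ b ∈ B, bad b ≤ 32 * K * (n ^ 2 * δ) :=
      mul_le_mul_of_nonneg_left hbad (by linarith)
    have h5 : 0 < n ^ 3 / K ^ 2 / 72 := by positivity
    linarith
  have hbad0 : 0 ≤ bad b := sum_nonneg fun _ _ ↦ Nat.cast_nonneg _
  refine ⟨X b, (filter_subset _ _).trans (filter_subset _ _), ?_, ?_, ?_⟩
  · intro a ha
    exact (mem_filter.1 (mem_filter.1 ha).1).2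
  · refine (sq_le_sq₀ (by positivity) (by positivity)).1 ?_
    have h2 : 0 ≤ 32 * K * bad b := mul_nonneg (by linarith) hbad0
    linarith
  · change bad b ≤ _
    rw [le_div_iff₀ (by positivity)]
    have h1 : 0 ≤ n ^ 2 / (9 * K ^ 2) := by positivity
    linarith

open Finset Classical in
/-- A dense bipartite graph has a dense induced subgraph on `A' × B'` such that any `a ∈ A'` and
`b ∈ B'` are joined by many paths of length three. -/
lemma exists_subsets_many_paths_length_three {α β : Type*} (A : Finset α) (B : Finset β)
    (r : α → β → Prop) {n K : ℝ} (hn : 0 < n) (hK : 1 ≤ K) (hA : #A ≤ n) (hB : #B ≤ n)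
    (hr : n ^ 2 / K ≤ ∑ a ∈ A, (#{b ∈ B | r a b} : ℝ)) :
    ∃ A' ⊆ A, ∃ B' ⊆ B, n ^ 2 / (24 * K ^ 2) ≤ #{p ∈ A' ×ˢ B' | r p.1 p.2} ∧
      ∀ a ∈ A', ∀ b ∈ B', n ^ 2 / (12288 * K ^ 5) ≤
        #{p ∈ A ×ˢ B | r a p.2 ∧ r p.1 p.2 ∧ r p.1 b} := by
  have hK0 : 0 < K := by linarith
  obtain ⟨X, hXA, hXdeg, hXcard, hXbad⟩ := exists_neighborhood_few_bad_pairs A B r hn hK hA hB hr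
  set δ := n / (256 * K ^ 3) with hδ
  have hδ0 : 0 ≤ δ := by positivity
  set m := (#X : ℝ) with hm
  have hm0 : 0 < m := lt_of_lt_of_le (by positivity) hXcard
  let bad : α → Finset α := fun a ↦ {a' ∈ X | (#{b ∈ B | r a b ∧ r a' b} : ℝ) < δ}
  change ∑ a ∈ X, (#(bad a) : ℝ) ≤ _ at hXbad
  set A' := {a ∈ X | (#(bad a) : ℝ) ≤ m / (16 * K)} with hA'
  set B' := {b ∈ B | m / (8 * K) ≤ #{a ∈ X | r a b}} with hB'
  have hA'card : m / 2 ≤ #A' := by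
    have h1 : #{a ∈ X | ¬(#(bad a) : ℝ) ≤ m / (16 * K)} • (m / (16 * K))
        ≤ ∑ a ∈ X with ¬(#(bad a) : ℝ) ≤ m / (16 * K), (#(bad a) : ℝ) :=
      card_nsmul_le_sum _ _ _ fun a ha ↦ (not_le.1 (mem_filter.1 ha).2).le
    have h2 : ∑ a ∈ X with ¬(#(bad a) : ℝ) ≤ m / (16 * K), (#(bad a) : ℝ)
        ≤ ∑ a ∈ X, (#(bad a) : ℝ) :=
      sum_le_sum_of_subset_of_nonneg (filter_subset _ _) fun _ _ _ ↦ by positivity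
    rw [nsmul_eq_mul] at h1
    have h3 : (#A' : ℝ) + #{a ∈ X | ¬(#(bad a) : ℝ) ≤ m / (16 * K)} = m :=
      (Nat.cast_add _ _).symm.trans (congrArg Nat.cast (card_filter_add_card_filter_not _))
    have h4 : m ^ 2 / (32 * K) = m / 2 * (m / (16 * K)) := by field_simp; ring
    have h5 := le_of_mul_le_mul_right (h4 ▸ h1.trans (h2.trans hXbad)) (by positivity)
    linarith
  refine ⟨A', (filter_subset _ _).trans hXA, B', filter_subset _ _, ?_, ?_⟩
  · rw [card_filter_product_eq_sum A' B' r, sum_card_filter_comm]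
    have hsub : ∑ b ∈ B with m / (8 * K) ≤ #{a ∈ A' | r a b}, (#{a ∈ A' | r a b} : ℝ)
        ≤ ∑ b ∈ B', (#{a ∈ A' | r a b} : ℝ) := by
      refine sum_le_sum_of_subset_of_nonneg (fun b hb ↦ ?_) fun _ _ _ ↦ by positivity
      rw [mem_filter] at hb ⊢
      refine ⟨hb.1, hb.2.trans ?_⟩
      gcongr
      exact filter_subset _ _
    have h1 := B.sum_le_sum_filter_le_add_card_mul (fun b ↦ (#{a ∈ A' | r a b} : ℝ))
      (c := m / (8 * K)) (by positivity)
    rw [← sum_card_filter_comm A' B r] at h1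
    have h2 : #A' • (n / (2 * K)) ≤ ∑ a ∈ A', (#{b ∈ B | r a b} : ℝ) :=
      card_nsmul_le_sum _ _ _ fun a ha ↦ hXdeg a (mem_filter.1 ha).1
    rw [nsmul_eq_mul] at h2
    have h3 : (m / 2) * (n / (2 * K)) ≤ #A' * (n / (2 * K)) := by gcongr
    have h4 : #B * (m / (8 * K)) ≤ n * (m / (8 * K)) := by gcongr
    have h5 : (m / 2) * (n / (2 * K)) - n * (m / (8 * K)) = m * (n / (8 * K)) := by
      field_simp; ring
    have h6 : n / (3 * K) * (n / (8 * K)) ≤ m * (n / (8 * K)) := by gcongr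
    have h7 : n / (3 * K) * (n / (8 * K)) = n ^ 2 / (24 * K ^ 2) := by field_simp; ring
    linarith
  · intro a ha b hb
    set Y := {a' ∈ X | r a' b} \ bad a with hY
    have hYcard : m / (16 * K) ≤ #Y := by
      have h1 : (#{a' ∈ X | r a' b} : ℝ) ≤ #Y + #(bad a) := by
        exact_mod_cast card_le_card_sdiff_add_card
      have h2 := (mem_filter.1 ha).2
      have h3 := (mem_filter.1 hb).2
      have h4 : m / (8 * K) = m / (16 * K) + m / (16 * K) := by field_simp; ring
      linarith
    rw [card_filter_product_eq_sum A B (fun a' b' ↦ r a b' ∧ r a' b' ∧ r a' b)]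
    calc n ^ 2 / (12288 * K ^ 5) = n / (3 * K) / (16 * K) * δ := by rw [hδ]; field_simp; ring
      _ ≤ #Y • δ := by
          rw [nsmul_eq_mul]
          gcongr
          refine le_trans ?_ hYcard
          gcongr
      _ ≤ ∑ a' ∈ Y, (#{b' ∈ B | r a b' ∧ r a' b' ∧ r a' b} : ℝ) := by
          refine card_nsmul_le_sum _ _ _ fun a' ha' ↦ ?_
          simp only [hY, bad, mem_sdiff, mem_filter, not_and, not_lt] at ha'
          refine (ha'.2 ha'.1.1).trans ?_
          gcongr with b'
          exact fun h ↦ ⟨h, ha'.1.2⟩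
      _ ≤ _ := by
          refine sum_le_sum_of_subset_of_nonneg (fun a' ha' ↦ hXA ?_) fun _ _ _ ↦ by positivity
          exact (mem_filter.1 (mem_sdiff.1 ha').1).1

open Finset Pointwise in
/-- If any `a ∈ A'` and `b ∈ B'` are joined by at least `P` paths of length three in `G`, then
`#(A' + B') * P` is at most the cube of the number of sums along `G`. -/
lemma card_add_mul_le_card_image_add_pow_three {M : Type*} [AddCommGroup M]
    [DecidableEq M] (A B A' B' : Finset M) (G : Finset (M × M)) {P : ℝ}
    (hP : ∀ a ∈ A', ∀ b ∈ B',
      P ≤ #{p ∈ A ×ˢ B | (a, p.2) ∈ G ∧ (p.1, p.2) ∈ G ∧ (p.1, b) ∈ G}) :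
    #(A' + B') * P ≤ (#(G.image fun p ↦ p.1 + p.2) : ℝ) ^ 3 := by
  set S := G.image fun p ↦ p.1 + p.2 with hS
  have hmem {x y : M} (h : (x, y) ∈ G) : x + y ∈ S := mem_image.2 ⟨_, h, rfl⟩
  let f : M × M × M → M := fun t ↦ t.1 - t.2.1 + t.2.2
  have hfib : ∀ s ∈ A' + B', P ≤ #{t ∈ S ×ˢ S ×ˢ S | f t = s} := by
    intro s hs
    obtain ⟨a, ha, b, hb, rfl⟩ := mem_add.1 hs
    refine (hP a ha b hb).trans ?_
    norm_cast
    refine card_le_card_of_injOn (fun p ↦ (a + p.2, p.1 + p.2, p.1 + b)) ?_ ?_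
    · intro p hp
      obtain ⟨-, h1, h2, h3⟩ := mem_filter.1 hp
      simp only [coe_filter, Set.mem_ofPred_eq, mem_product]
      refine ⟨⟨hmem h1, hmem h2, hmem h3⟩, ?_⟩
      simp only [f]
      abel
    · rintro ⟨x, y⟩ - ⟨z, w⟩ - h
      simp only [Prod.mk.injEq, add_right_inj, add_left_inj] at h
      exact Prod.ext h.2.2 h.1
  calc #(A' + B') * P ≤ ∑ s ∈ A' + B', (#{t ∈ S ×ˢ S ×ˢ S | f t = s} : ℝ) := by
        rw [← nsmul_eq_mul]
        exact card_nsmul_le_sum _ _ _ hfib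
    _ ≤ (#(S ×ˢ S ×ˢ S) : ℝ) := by
        norm_cast
        rw [sum_card_fiberwise_eq_card_filter]
        exact card_filter_le _ _
    _ = (#S : ℝ) ^ 3 := by
        simp only [card_product, Nat.cast_mul]
        ring

open Finset Pointwise in
lemma card_sub_mul_card_mul_card_le_card_add_pow_three {M : Type*} [AddCommGroup M]
    [DecidableEq M] (A B : Finset M) : #(A - B) * #A * #B ≤ #(A + B) ^ 3 := by
  have h1 := card_sub_add_le_card_sub_add_card_add A A B
  have h2 := ruzsa_triangle_inequality_sub_add_add A B A
  calc #(A - B) * #A * #B ≤ #(A - A) * #(A + B) * #B := by gcongr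
    _ = #(A - A) * #B * #(A + B) := by ring
    _ ≤ #(A + B) * #(A + B) * #(A + B) := by gcongr
    _ = #(A + B) ^ 3 := by ring

open Finset Pointwise in
/-- A polynomial **Balog–Szemerédi–Gowers theorem** for differences, in which the subsets found
retain a large part of the graph. -/
theorem balog_szemeredi_gowers_sub {M : Type*} [AddCommGroup M] [DecidableEq M]
    (A B : Finset M) (G : Finset (M × M)) {n K : ℝ} (hn : 0 < n) (hK : 1 ≤ K)
    (hA : #A ≤ n) (hB : #B ≤ n) (hGAB : G ⊆ A ×ˢ B)
    (hS : (#(G.image fun p ↦ p.1 + p.2) : ℝ) ≤ n) (hG : n ^ 2 / K ≤ #G) :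
    ∃ A' ⊆ A, ∃ B' ⊆ B, n ^ 2 / (24 * K ^ 2) ≤ #(G ∩ A' ×ˢ B') ∧
      (#((A' ×ˢ B').image fun p ↦ p.1 - p.2) : ℝ) ≤ 24 * 12288 ^ 3 * K ^ 17 * n := by
  classical
  have hK0 : 0 < K := by linarith
  have hfilter (A' B' : Finset M) :
      G ∩ A' ×ˢ B' = {p ∈ A' ×ˢ B' | (p.1, p.2) ∈ G} := by
    ext p
    simp [and_comm]
  obtain ⟨A', hA', B', hB', hcard, hpaths⟩ := exists_subsets_many_paths_length_three A B
    (fun a b ↦ (a, b) ∈ G) hn hK hA hB (by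
      rw [← inter_eq_left.2 hGAB, hfilter,
        card_filter_product_eq_sum A B (fun a b ↦ (a, b) ∈ G)] at hG
      convert hG)
  have hcard' : n ^ 2 / (24 * K ^ 2) ≤ #(G ∩ A' ×ˢ B') := by
    rw [hfilter]
    convert hcard
  refine ⟨A', hA', B', hB', hcard', ?_⟩
  change (#(A' - B') : ℝ) ≤ _
  have hadd : (#(A' + B') : ℝ) ≤ 12288 * K ^ 5 * n := by
    have h := card_add_mul_le_card_image_add_pow_three A B A' B' G (P := n ^ 2 / (12288 * K ^ 5))
      fun a ha b hb ↦ by convert hpaths a ha b hb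
    have h1 : (#(A' + B') : ℝ) * (n ^ 2 / (12288 * K ^ 5)) ≤ n ^ 3 := by
      refine h.trans (by gcongr)
    have h2 : n ^ 3 = 12288 * K ^ 5 * n * (n ^ 2 / (12288 * K ^ 5)) := by field_simp
    exact le_of_mul_le_mul_right (h2 ▸ h1) (by positivity)
  have hprod : n ^ 2 / (24 * K ^ 2) ≤ (#A' : ℝ) * #B' := by
    refine hcard'.trans ?_
    rw [← Nat.cast_mul, ← card_product]
    gcongr
    exact inter_subset_right
  have h : (#(A' - B') : ℝ) * #A' * #B' ≤ (#(A' + B') : ℝ) ^ 3 := by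
    exact_mod_cast card_sub_mul_card_mul_card_le_card_add_pow_three A' B'
  refine le_of_mul_le_mul_right (a := n ^ 2 / (24 * K ^ 2)) ?_ (by positivity)
  calc (#(A' - B') : ℝ) * (n ^ 2 / (24 * K ^ 2)) ≤ #(A' - B') * (#A' * #B') := by gcongr
    _ = #(A' - B') * #A' * #B' := by ring
    _ ≤ (12288 * K ^ 5 * n) ^ 3 := h.trans (by gcongr)
    _ = 24 * 12288 ^ 3 * K ^ 17 * n * (n ^ 2 / (24 * K ^ 2)) := by field_simp

/-- Key refinement with small difference set (Proposition 14.7): if A, B ⊆ ℤ have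
cardinality at most N, G ⊆ A × B has restricted sumset of cardinality at most N and
#G ≥ N^{2−c₀√ε}, then there are subsets A' ⊆ A and B' ⊆ B with
#(G ∩ (A' × B')) ≥ N^{2−C√ε} and #{a' − b' : (a',b') ∈ A' × B'} ≤ N^{1+C√ε}. -/
theorem key_refinement_small_differences (c₀ : ℝ) (hc₀ : 0 < c₀) :
    ∃ C ε₀ : ℝ, 0 < C ∧ 0 < ε₀ ∧
      ∀ ε : ℝ, 0 < ε → ε < ε₀ →
        ∃ N₀ : ℝ, ∀ N : ℝ, N₀ ≤ N →
          ∀ A B : Finset ℤ, (A.card : ℝ) ≤ N → (B.card : ℝ) ≤ N →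
            ∀ G : Finset (ℤ × ℤ), G ⊆ A ×ˢ B →
              ((G.image fun p => p.1 + p.2).card : ℝ) ≤ N →
              N ^ (2 - c₀ * Real.sqrt ε) ≤ (G.card : ℝ) →
              ∃ A' B' : Finset ℤ, A' ⊆ A ∧ B' ⊆ B ∧
                N ^ (2 - C * Real.sqrt ε) ≤ ((G ∩ (A' ×ˢ B')).card : ℝ) ∧
                (((A' ×ˢ B').image fun p => p.1 - p.2).card : ℝ) ≤
                  N ^ (1 + C * Real.sqrt ε) := by
  refine ⟨18 * c₀, 1, by positivity, one_pos, fun ε hε _ ↦ ?_⟩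
  have hd : 0 < c₀ * √ε := by positivity
  obtain ⟨N₁, hN₁⟩ := Filter.eventually_atTop.1
    ((tendsto_rpow_atTop hd).eventually_ge_atTop (24 * 12288 ^ 3 : ℝ))
  refine ⟨max N₁ 1, fun N hN A B hA hB G hGAB hS hG ↦ ?_⟩
  have hN1 : 1 ≤ N := (le_max_right _ _).trans hN
  have hN0 : 0 < N := by linarith
  set d := c₀ * √ε with hd'
  have hC : 24 * 12288 ^ 3 ≤ N ^ d := hN₁ N ((le_max_left _ _).trans hN)
  have hK : 1 ≤ N ^ d := Real.one_le_rpow hN1 hd.le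
  have hpow (k : ℕ) : (N ^ d) ^ k = N ^ (d * k) := by rw [Real.rpow_mul_natCast hN0.le]
  obtain ⟨A', hA', B', hB', hcard, hsub⟩ := balog_szemeredi_gowers_sub A B G hN0 hK hA hB hGAB hS
    (by rwa [Real.rpow_sub hN0, Real.rpow_two] at hG)
  refine ⟨A', B', hA', hB', le_trans ?_ hcard, ?_⟩
  · have h1 : 24 * (N ^ d) ^ 2 ≤ (N ^ d) ^ 18 :=
      calc 24 * (N ^ d) ^ 2 ≤ N ^ d * (N ^ d) ^ 2 := by gcongr; linarith
        _ = (N ^ d) ^ 3 := by ring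
        _ ≤ (N ^ d) ^ 18 := pow_le_pow_right₀ hK (by norm_num)
    have h2 : N ^ (2 - 18 * c₀ * √ε) = N ^ 2 / (N ^ d) ^ 18 := by
      rw [hpow, Real.rpow_sub hN0, Real.rpow_two, hd']
      congr 2
      push_cast
      ring
    rw [h2]
    gcongr
  · have h2 : N ^ (1 + 18 * c₀ * √ε) = (N ^ d) ^ 18 * N := by
      rw [hpow, Real.rpow_add hN0, Real.rpow_one, mul_comm, hd']
      congr 2
      push_cast
      ring
    rw [h2]
    refine hsub.trans ?_
    calc 24 * 12288 ^ 3 * (N ^ d) ^ 17 * N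
        ≤ N ^ d * (N ^ d) ^ 17 * N := by gcongr
      _ = (N ^ d) ^ 18 * N := by ring
end
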